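/- Let G with list assignment L and precolored path P be a minimal counterexample configuration for the precolored-path 5-choosability theorem. Then every vertex v of G satisfies deg(v) ≥ |L(v)|, and G is 2-connected; in particular, the outer face of G is bounded by a cycle. -/

import Mathlib

open Set

noncomputable section

/-- A drawing of a simple graph in the plane: vertices are mapped to distinct points,
each edge is realized by a simple arc joining the images of its endpoints, arcs do not
pass through vertex points, any two arcs realizing distinct edges meet in at most one
point, and no point of the plane that is not a vertex point lies on three or more arcs. -/
structure Drawing {V : Type} (G : SimpleGraph V) where
  pos : V → ℝ × ℝ
  pos_inj : Function.Injective pos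
  arc : ∀ ⦃u v : V⦄, G.Adj u v → Path (pos u) (pos v)
  arc_symm : ∀ ⦃u v : V⦄ (h : G.Adj u v), arc h.symm = (arc h).symm
  arc_inj : ∀ ⦃u v : V⦄ (h : G.Adj u v), Function.Injective ⇑(arc h)
  arc_vertex : ∀ ⦃u v : V⦄ (h : G.Adj u v) (t : unitInterval) (w : V),
    arc h t = pos w → t = 0 ∨ t = 1
  arc_meet_once : ∀ ⦃u v x y : V⦄ (h₁ : G.Adj u v) (h₂ : G.Adj x y),
    s(u, v) ≠ s(x, y) → (Set.range ⇑(arc h₁) ∩ Set.range ⇑(arc h₂)).Subsingleton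
  arc_no_triple : ∀ ⦃u₁ v₁ u₂ v₂ u₃ v₃ : V⦄ (h₁ : G.Adj u₁ v₁) (h₂ : G.Adj u₂ v₂)
    (h₃ : G.Adj u₃ v₃), s(u₁, v₁) ≠ s(u₂, v₂) → s(u₁, v₁) ≠ s(u₃, v₃) →
    s(u₂, v₂) ≠ s(u₃, v₃) →
    ∀ p ∈ Set.range ⇑(arc h₁) ∩ Set.range ⇑(arc h₂) ∩ Set.range ⇑(arc h₃),
      ∃ w : V, p = pos w

namespace Drawing

variable {V : Type} {G : SimpleGraph V} (D : Drawing G)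

/-- The set of points used by the arc of an edge. -/
def arcSet ⦃u v : V⦄ (h : G.Adj u v) : Set (ℝ × ℝ) :=
  Set.range ⇑(D.arc h)

/-- The set of interior points of the arc of an edge. -/
def arcInterior ⦃u v : V⦄ (h : G.Adj u v) : Set (ℝ × ℝ) :=
  ⇑(D.arc h) '' {t : unitInterval | t ≠ 0 ∧ t ≠ 1}

/-- All points of the plane used by the drawing. -/
def graphSet : Set (ℝ × ℝ) :=
  Set.range D.pos ∪ ⋃ (u : V) (v : V) (h : G.Adj u v), D.arcSet h

/-- A crossing of a drawing: a point interior to the arcs of two distinct edges. -/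
def IsCrossing (p : ℝ × ℝ) : Prop :=
  ∃ (u v x y : V) (h₁ : G.Adj u v) (h₂ : G.Adj x y),
    s(u, v) ≠ s(x, y) ∧ p ∈ D.arcInterior h₁ ∧ p ∈ D.arcInterior h₂

/-- A drawing is plane if it has no crossings. -/
def IsPlane : Prop := ∀ p : ℝ × ℝ, ¬ D.IsCrossing p

/-- The faces of a drawing are the connected components of the complement
of the drawing. -/
def IsFace (f : Set (ℝ × ℝ)) : Prop :=
  ∃ q : ℝ × ℝ, q ∉ D.graphSet ∧ f = connectedComponentIn D.graphSetᶜ q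

/-- The outer (unbounded) face of a drawing. -/
def outerFace : Set (ℝ × ℝ) :=
  {p : ℝ × ℝ | p ∉ D.graphSet ∧
    ¬ Bornology.IsBounded (connectedComponentIn D.graphSetᶜ p)}

/-- A vertex lies on the outer face if its point is on the boundary of the outer face. -/
def OnOuter (v : V) : Prop := D.pos v ∈ frontier D.outerFace

/-- The set of points of the plane used by the drawing of a walk. -/
def walkSet {a b : V} (W : G.Walk a b) : Set (ℝ × ℝ) :=
  D.pos '' {v : V | v ∈ W.support} ∪ ⋃ d ∈ W.darts, D.arcSet d.adj

/-- A closed walk bounds the outer face if the boundary of the outer face is exactly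
the drawing of the walk. -/
def BoundsOuter {a : V} (W : G.Walk a a) : Prop :=
  frontier D.outerFace = D.walkSet W

end Drawing

/-- The open region enclosed by a set `S` (typically the drawing of a cycle):
all points outside `S` whose connected component in the complement of `S` is bounded. -/
def enclosed (S : Set (ℝ × ℝ)) : Set (ℝ × ℝ) :=
  {p : ℝ × ℝ | p ∉ S ∧ Bornology.IsBounded (connectedComponentIn Sᶜ p)}

namespace Drawing

variable {V : Type} {G : SimpleGraph V} (D : Drawing G)

/-- The closed disc bounded by (the drawing of) a closed walk. -/
def closedDisc {a : V} (W : G.Walk a a) : Set (ℝ × ℝ) :=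
  D.walkSet W ∪ enclosed (D.walkSet W)

/-- The endpoints of the (two) edges incident with a crossing point `p`. -/
def crossingEnds (p : ℝ × ℝ) : Set V :=
  {w : V | ∃ (z : V) (h : G.Adj w z), p ∈ D.arcInterior h}

end Drawing

/-- A proper colouring of `G` from the lists `L`. -/
def IsListColoring {V : Type} (G : SimpleGraph V) (L : V → Finset ℕ) (c : V → ℕ) : Prop :=
  (∀ v, c v ∈ L v) ∧ ∀ ⦃u v : V⦄, G.Adj u v → c u ≠ c v

/-- `G` is colourable from the lists `L`. -/
def ListColorable {V : Type} (G : SimpleGraph V) (L : V → Finset ℕ) : Prop :=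
  ∃ c : V → ℕ, IsListColoring G L c


/-- A counterexample configuration for the precolored-path 5-choosability theorem:
a plane graph `G` (on vertex set `Fin n`), a path `P` of length at most two contained in
the boundary of the outer face, and a list assignment `L` satisfying conditions
(i)–(vi) of the theorem, such that `G` is not `L`-colorable. -/
structure Config where
  n : ℕ
  G : SimpleGraph (Fin n)
  D : Drawing G
  plane : D.IsPlane
  a : Fin n
  b : Fin n
  P : G.Walk a b
  P_path : P.IsPath
  P_len : P.length ≤ 2
  P_boundary : D.walkSet P ⊆ frontier D.outerFace
  L : Fin n → Finset ℕ
  size5 : ∀ v, ¬ D.OnOuter v → 5 ≤ (L v).card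
  size3 : ∀ v, D.OnOuter v → v ∉ P.support → 3 ≤ (L v).card
  size1 : ∀ v ∈ P.support, (L v).card = 1
  no_adjacent_3 : ∀ u v, G.Adj u v → (L u).card = 3 → (L v).card ≠ 3
  proper_on_P : ∀ u ∈ P.support, ∀ v ∈ P.support, G.Adj u v → L u ≠ L v
  common_neighbor : ∀ p₀ p₁ p₂ : Fin n, P.support = [p₀, p₁, p₂] →
    ∀ x, G.Adj x p₀ → G.Adj x p₁ → G.Adj x p₂ → L x ≠ L p₀ ∪ L p₁ ∪ L p₂
  not_colorable : ¬ ListColorable G L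

/-- The number of vertices plus the number of edges of a configuration. -/
def Config.size (C : Config) : ℕ := C.n + C.G.edgeSet.ncard

/-- The length of the precolored path of a configuration. -/
def Config.plen (C : Config) : ℕ := C.P.length

/-- The total size of the lists of a configuration. -/
def Config.lsize (C : Config) : ℕ := ∑ v : Fin C.n, (C.L v).card

/-- A minimal counterexample configuration: `|V(G)| + |E(G)|` is minimum, subject to
that the precolored path is as long as possible, and subject to that the total size of
the lists is minimum. -/
def Config.Minimal (C : Config) : Prop :=
  (∀ C' : Config, C.size ≤ C'.size) ∧
  (∀ C' : Config, C'.size = C.size → C'.plen ≤ C.plen) ∧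
  (∀ C' : Config, C'.size = C.size → C'.plen = C.plen → C.lsize ≤ C'.lsize)

/-- A graph is 2-connected if it has at least three vertices and deleting any single
vertex leaves a connected graph. -/
def TwoConnected {V : Type} [Fintype V] (G : SimpleGraph V) : Prop :=
  3 ≤ Fintype.card V ∧ ∀ v : V, (G.induce ({v}ᶜ : Set V)).Connected

namespace PlaneTop

/-- Identification of the plane with the complex numbers. -/
def toC (z : ℝ × ℝ) : ℂ := ⟨z.1, z.2⟩

lemma toC_continuous : Continuous toC := by
  have h : toC = fun z : ℝ × ℝ => (z.1 : ℂ) + (z.2 : ℂ) * Complex.I := by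
    funext z
    apply Complex.ext <;> simp [toC]
  rw [h]; fun_prop

lemma toC_injective : Function.Injective toC := by
  intro x y h
  have h1 := congrArg Complex.re h
  have h2 := congrArg Complex.im h
  exact Prod.ext h1 h2

lemma toC_sub_ne {x y : ℝ × ℝ} (h : x ≠ y) : toC x - toC y ≠ 0 := by
  intro h'
  exact h (toC_injective (sub_eq_zero.1 h'))

/-- `f` has a continuous logarithm on `K`. -/
def HasLog {X : Type*} [TopologicalSpace X] (f : X → ℂ) (K : Set X) : Prop :=
  ∃ g : X → ℂ, ContinuousOn g K ∧ ∀ z ∈ K, Complex.exp (g z) = f z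

section
variable {X : Type*} [TopologicalSpace X] {f g : X → ℂ} {K K' : Set X}

lemma HasLog.mono (h : HasLog f K) (hK : K' ⊆ K) : HasLog f K' := by
  obtain ⟨l, h1, h2⟩ := h
  exact ⟨l, h1.mono hK, fun z hz => h2 z (hK hz)⟩

lemma HasLog.congr (h : HasLog f K) (hfg : ∀ z ∈ K, f z = g z) : HasLog g K := by
  obtain ⟨l, h1, h2⟩ := h
  exact ⟨l, h1, fun z hz => (h2 z hz).trans (hfg z hz)⟩

lemma HasLog.mul (h : HasLog f K) (h' : HasLog g K) : HasLog (fun z => f z * g z) K := by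
  obtain ⟨l, h1, h2⟩ := h
  obtain ⟨m, h3, h4⟩ := h'
  exact ⟨fun z => l z + m z, h1.add h3, fun z hz => by
    rw [Complex.exp_add, h2 z hz, h4 z hz]⟩

lemma HasLog.const {c : ℂ} (hc : c ≠ 0) : HasLog (fun _ : X => c) K :=
  ⟨fun _ => Complex.log c, continuousOn_const, fun _ _ => Complex.exp_log hc⟩

/-- Homotopy lifting for the exponential map. -/
lemma HasLog.lift (F : unitInterval → X → ℂ)
    (hF : ContinuousOn (fun q : unitInterval × X => F q.1 q.2) (univ ×ˢ K))
    (hne : ∀ t, ∀ z ∈ K, F t z ≠ 0) (h0 : HasLog (F 0) K) : HasLog (F 1) K := by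
  classical
  obtain ⟨l, h1, h2⟩ := h0
  let H : C(unitInterval × K, {z : ℂ // z ≠ 0}) :=
    ⟨fun q => ⟨F q.1 q.2, hne q.1 q.2 q.2.2⟩, by
      refine Continuous.subtype_mk ?_ _
      have : (fun q : unitInterval × K => F q.1 q.2) =
        (fun q : unitInterval × X => F q.1 q.2) ∘ (fun q : unitInterval × K => (q.1, (q.2 : X))) :=
        rfl
      rw [this]
      exact hF.comp_continuous (by fun_prop) (fun q => ⟨mem_univ _, q.2.2⟩)⟩
  let f0 : C(K, ℂ) := ⟨fun z => l z, continuousOn_iff_continuous_domRestrict.1 h1⟩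
  have H0 : ∀ a, H (0, a) = (⟨_, (f0 a).exp_ne_zero⟩ : {z : ℂ // z ≠ 0}) := by
    intro a
    apply Subtype.ext
    exact (h2 a a.2).symm
  let m := Complex.isCoveringMap_exp.liftHomotopy H f0 H0
  have hm : ∀ q, Complex.exp (m q) = F q.1 q.2 := by
    intro q
    have := congrFun (Complex.isCoveringMap_exp.liftHomotopy_lifts H f0 H0) q
    exact congrArg Subtype.val this
  refine ⟨fun z => if hz : z ∈ K then m (1, ⟨z, hz⟩) else 0, ?_, ?_⟩
  · rw [continuousOn_iff_continuous_domRestrict]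
    have : (K.domRestrict fun z => if hz : z ∈ K then m (1, ⟨z, hz⟩) else 0) =
        fun z : K => m (1, z) := by
      funext z
      simp [Set.domRestrict]
    rw [this]
    fun_prop
  · intro z hz
    simp only [hz, dif_pos]
    exact hm (1, ⟨z, hz⟩)

lemma isDiscrete_range_mul : IsDiscrete {w : ℂ | Complex.exp w = 1} := by
  have h : {w : ℂ | Complex.exp w = 1} =
      (AddSubgroup.zmultiples (2 * Real.pi * Complex.I) : Set ℂ) := by
    ext w
    simp only [mem_ofPred_eq, SetLike.mem_coe, AddSubgroup.mem_zmultiples_iff,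
      Complex.exp_eq_one_iff, zsmul_eq_mul]
    exact ⟨fun ⟨n, hn⟩ => ⟨n, hn.symm⟩, fun ⟨n, hn⟩ => ⟨n, hn.symm⟩⟩
  rw [h]
  exact ⟨NormedSpace.discreteTopology_zmultiples _⟩

lemma log_diff_const {l m : X → ℂ} (hl : ContinuousOn l K) (hm : ContinuousOn m K)
    (h : ∀ z ∈ K, Complex.exp (l z) = Complex.exp (m z)) (hK : IsPreconnected K) :
    ∃ c : ℂ, Complex.exp c = 1 ∧ ∀ z ∈ K, l z = m z + c := by
  rcases K.eq_empty_or_nonempty with rfl | ⟨x, hx⟩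
  · exact ⟨0, by simp, by simp⟩
  have hmt : MapsTo (fun z => l z - m z) K {w : ℂ | Complex.exp w = 1} := by
    intro z hz
    simp only [mem_ofPred_eq, Complex.exp_sub, h z hz]
    exact div_self (Complex.exp_ne_zero _)
  refine ⟨l x - m x, hmt hx, fun z hz => ?_⟩
  have : l z - m z = l x - m x :=
    hK.constant_of_mapsTo isDiscrete_range_mul (hl.sub hm) hmt hz hx
  rw [← this]; ring

lemma HasLog.glue_aux (hU : ∀ g : X → ℂ, ContinuousOn g K → ContinuousOn g K' →
      ContinuousOn g (K ∪ K'))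
    (hc : IsPreconnected (K ∩ K')) (h : HasLog f K) (h' : HasLog f K') :
    HasLog f (K ∪ K') := by
  classical
  obtain ⟨l, h1, h2⟩ := h
  obtain ⟨m, h3, h4⟩ := h'
  obtain ⟨c, hc1, hc2⟩ := log_diff_const (h1.mono inter_subset_left) (h3.mono inter_subset_right)
    (fun z hz => (h2 z hz.1).trans (h4 z hz.2).symm) hc
  let n : X → ℂ := fun z => if z ∈ K then l z else m z + c
  have e1 : EqOn n l K := fun z hz => by simp [n, hz]
  have e2 : EqOn n (fun z => m z + c) K' := fun z hz => by
    by_cases hk : z ∈ K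
    · simp [n, hk, hc2 z ⟨hk, hz⟩]
    · simp [n, hk]
  refine ⟨n, hU n (h1.congr e1) ((h3.add continuousOn_const).congr e2), ?_⟩
  rintro z (hz | hz)
  · rw [e1 hz, h2 z hz]
  · rw [e2 hz, Complex.exp_add, hc1, mul_one, h4 z hz]

lemma HasLog.glue (hK : IsClosed K) (hK' : IsClosed K')
    (hc : IsPreconnected (K ∩ K')) (h : HasLog f K) (h' : HasLog f K') :
    HasLog f (K ∪ K') :=
  HasLog.glue_aux (fun _ a b => a.union_of_isClosed b hK hK') hc h h'

lemma HasLog.glue_open (hK : IsOpen K) (hK' : IsOpen K')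
    (hc : IsPreconnected (K ∩ K')) (h : HasLog f K) (h' : HasLog f K') :
    HasLog f (K ∪ K') :=
  HasLog.glue_aux (fun _ a b => a.union_of_isOpen b hK hK') hc h h'

end

/-- the circle of radius `r` around `p` -/
def circ (p : ℝ × ℝ) (r : ℝ) (θ : ℝ) : ℝ × ℝ := (p.1 + r * Real.cos θ, p.2 + r * Real.sin θ)

lemma circ_continuous (p : ℝ × ℝ) (r : ℝ) : Continuous (circ p r) := by
  unfold circ; fun_prop

lemma toC_circ (p : ℝ × ℝ) (r θ : ℝ) :
    toC (circ p r θ) - toC p = r * Complex.exp (θ * Complex.I) := by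
  apply Complex.ext
  · simp [toC, circ, Complex.exp_ofReal_mul_I_re]
  · simp [toC, circ, Complex.exp_ofReal_mul_I_im]

lemma not_hasLog_circ (p : ℝ × ℝ) {r : ℝ} (hr : 0 < r) :
    ¬ HasLog (fun z => toC z - toC p) (range (circ p r)) := by
  rintro ⟨l, h1, h2⟩
  have hc : Continuous (fun θ : ℝ => l (circ p r θ)) :=
    h1.comp_continuous (circ_continuous p r) (fun θ => mem_range_self θ)
  have hr' : (r : ℂ) ≠ 0 := by exact_mod_cast hr.ne'
  obtain ⟨c, -, hc2⟩ := log_diff_const (K := univ) (l := fun θ : ℝ => l (circ p r θ))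
    (m := fun θ : ℝ => Complex.log r + θ * Complex.I) hc.continuousOn
    (by fun_prop) (fun θ _ => by
      rw [h2 _ (mem_range_self θ)]; simp only [toC_circ]; rw [Complex.exp_add, Complex.exp_log hr'])
    isPreconnected_univ
  have a1 := hc2 0 (mem_univ _)
  have a2 := hc2 (2 * Real.pi) (mem_univ _)
  have e : circ p r (2 * Real.pi) = circ p r 0 := by simp [circ]
  simp only [e] at a2
  rw [a1] at a2
  simp [Real.pi_ne_zero] at a2

/-- A nonvanishing continuous function on the plane has a logarithm. -/
lemma hasLog_univ {h : ℝ × ℝ → ℂ} (hc : Continuous h) (hn : ∀ z, h z ≠ 0) : HasLog h univ := by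
  have := HasLog.lift (K := (univ : Set (ℝ × ℝ))) (fun t z => h ((t : ℝ) • z))
    (by fun_prop) (fun t z _ => hn _) (by simpa using HasLog.const (hn 0))
  simpa using this

/-- The points outside `K` lying in unbounded components of the complement. -/
def ext (K : Set (ℝ × ℝ)) : Set (ℝ × ℝ) :=
  {p | p ∉ K ∧ ¬ Bornology.IsBounded (connectedComponentIn Kᶜ p)}

lemma frontier_comp_subset {K : Set (ℝ × ℝ)} (hK : IsClosed K) (p : ℝ × ℝ) :
    frontier (connectedComponentIn Kᶜ p) ⊆ K := by
  intro x hx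
  by_contra hxK
  have ho : IsOpen (connectedComponentIn Kᶜ x) := hK.isOpen_compl.connectedComponentIn
  have hop : IsOpen (connectedComponentIn Kᶜ p) := hK.isOpen_compl.connectedComponentIn
  have hxm : x ∈ connectedComponentIn Kᶜ x := mem_connectedComponentIn hxK
  rw [hop.frontier_eq] at hx
  obtain ⟨y, hy1, hy2⟩ := mem_closure_iff.1 hx.1 _ ho hxm
  have e1 := connectedComponentIn_eq hy1
  have e2 := connectedComponentIn_eq hy2
  rw [e2, ← e1] at hx
  exact hx.2 hxm

lemma subset_of_frontier {Y O : Set (ℝ × ℝ)} (hY : IsPreconnected Y) (hO : IsOpen O)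
    (hYO : (Y ∩ O).Nonempty) (hd : ∀ y ∈ Y, y ∉ frontier O) : Y ⊆ O := by
  have := hY.subset_left_of_subset_union hO (isClosed_closure (s := O)).isOpen_compl
    (disjoint_compl_right.mono_left subset_closure |>.mono_right le_rfl) (by
      intro y hy
      by_cases h : y ∈ O
      · exact Or.inl h
      · refine Or.inr fun hc => hd y hy ?_
        rw [hO.frontier_eq]; exact ⟨hc, h⟩) hYO
  exact this

lemma mem_ext_of_hasLog {K : Set (ℝ × ℝ)} (hK : IsClosed K) {p : ℝ × ℝ} (hp : p ∉ K)
    (h : HasLog (fun z => toC z - toC p) K) : p ∈ ext K := by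
  classical
  refine ⟨hp, fun hb => ?_⟩
  set W := connectedComponentIn Kᶜ p with hW
  have hpW : p ∈ W := mem_connectedComponentIn hp
  obtain ⟨l, h1, h2⟩ := h
  obtain ⟨L, hL⟩ := ContinuousMap.exists_restrict_eq hK
    (⟨K.domRestrict l, continuousOn_iff_continuous_domRestrict.1 h1⟩ : C(K, ℂ))
  have hLl : ∀ z ∈ K, L z = l z := fun z hz => by
    have := congrArg (fun q : C(K, ℂ) => q ⟨z, hz⟩) hL
    exact this
  let H : ℝ × ℝ → ℂ := W.piecewise (fun z => Complex.exp (L z)) (fun z => toC z - toC p)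
  have hH : Continuous H := by
    apply Continuous.piecewise
    · intro a ha
      have haK := frontier_comp_subset hK p ha
      simp only [hLl a haK, h2 a haK]
    · fun_prop
    · exact toC_continuous.sub continuous_const
  have hHn : ∀ z, H z ≠ 0 := by
    intro z
    by_cases hz : z ∈ W
    · simp [H, hz, Complex.exp_ne_zero]
    · simp only [H, hz, not_false_eq_true, piecewise_eq_of_notMem]
      exact toC_sub_ne (fun e => hz (e ▸ hpW))
  obtain ⟨R, hR⟩ := hb.subset_closedBall p
  have hR1 : 0 < 2 * |R| + 1 := by positivity
  apply not_hasLog_circ p hR1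
  refine ((hasLog_univ hH hHn).mono (subset_univ _)).congr ?_
  rintro _ ⟨θ, rfl⟩
  have : circ p (2 * |R| + 1) θ ∉ W := by
    intro hw
    have hd := hR hw
    rw [Metric.mem_closedBall, Prod.dist_eq] at hd
    simp only [circ, Real.dist_eq, add_sub_cancel_left, sup_le_iff] at hd
    have a := sq_le_sq' (by linarith [abs_nonneg ((2 * |R| + 1) * Real.cos θ), abs_nonneg R, le_abs_self R]) hd.1
    have b := sq_le_sq' (by linarith [abs_nonneg ((2 * |R| + 1) * Real.sin θ), abs_nonneg R, le_abs_self R]) hd.2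
    rw [sq_abs] at a b
    have := Real.sin_sq_add_cos_sq θ
    have h3 : (2 * |R| + 1)^2 ≤ 2 * R^2 := by nlinarith
    have : R ^ 2 = |R|^2 := (sq_abs R).symm
    nlinarith [abs_nonneg R]
  simp [H, this]

lemma norm_toC_le (z : ℝ × ℝ) : ‖toC z‖ ≤ 2 * ‖z‖ := by
  have := Complex.norm_le_abs_re_add_abs_im (toC z)
  have h1 : |z.1| ≤ ‖z‖ := norm_fst_le z
  have h2 : |z.2| ≤ ‖z‖ := norm_snd_le z
  simp only [toC] at this ⊢
  linarith

lemma le_norm_toC (z : ℝ × ℝ) : ‖z‖ ≤ ‖toC z‖ := by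
  rw [Prod.norm_def]
  exact sup_le (Complex.abs_re_le_norm (toC z)) (Complex.abs_im_le_norm (toC z))

/-- Far away points are in the exterior. -/
lemma hasLog_far {K : Set (ℝ × ℝ)} {R : ℝ} (hK : ∀ z ∈ K, ‖z‖ ≤ R) {q : ℝ × ℝ}
    (hq : 2 * R < ‖q‖) (hR : 0 ≤ R) : HasLog (fun z => toC z - toC q) K := by
  have hqn : 2 * R < ‖toC q‖ := hq.trans_le (le_norm_toC q)
  have hq0 : -toC q ≠ 0 := by
    intro h
    rw [neg_eq_zero] at h
    rw [h, norm_zero] at hqn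
    linarith
  have := HasLog.lift (K := K) (fun t z => ((t : ℝ) : ℂ) * toC z - toC q)
    (by have := toC_continuous; fun_prop) (fun t z hz h => by
      have e : toC q = ((t : ℝ) : ℂ) * toC z := (sub_eq_zero.1 h).symm
      rw [e, norm_mul, Complex.norm_real, Real.norm_eq_abs, abs_of_nonneg t.2.1] at hqn
      have a := norm_toC_le z
      have b := hK z hz
      have c : (t : ℝ) * ‖toC z‖ ≤ 1 * ‖toC z‖ :=
        mul_le_mul_of_nonneg_right t.2.2 (norm_nonneg _)
      linarith) (by simpa using HasLog.const hq0)
  simpa using this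

lemma exists_far {S : Set (ℝ × ℝ)} (hS : ¬ Bornology.IsBounded S) (R : ℝ) : ∃ q ∈ S, R < ‖q‖ := by
  by_contra h
  push Not at h
  exact hS (isBounded_iff_forall_norm_le.2 ⟨R, h⟩)

lemma exists_bound {K : Set (ℝ × ℝ)} (hK : IsCompact K) : ∃ R, 0 ≤ R ∧ ∀ z ∈ K, ‖z‖ ≤ R := by
  obtain ⟨R, hR⟩ := isBounded_iff_forall_norm_le.1 hK.isBounded
  exact ⟨|R|, abs_nonneg R, fun z hz => (hR z hz).trans (le_abs_self R)⟩

/-- Move the base point along a path in the complement. -/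
lemma hasLog_of_path {K : Set (ℝ × ℝ)} {p q : ℝ × ℝ} (γ : Path p q) (hγ : ∀ t, γ t ∉ K)
    (h : HasLog (fun z => toC z - toC p) K) : HasLog (fun z => toC z - toC q) K := by
  have := HasLog.lift (K := K) (fun t z => toC z - toC (γ t))
    (by have := toC_continuous; fun_prop)
    (fun t z hz => toC_sub_ne (fun e => hγ t (e ▸ hz))) (by simpa using h)
  simpa using this

lemma hasLog_of_mem_ext {K : Set (ℝ × ℝ)} (hK : IsCompact K) {p : ℝ × ℝ} (hp : p ∈ ext K) :
    HasLog (fun z => toC z - toC p) K := by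
  obtain ⟨R, hR0, hR⟩ := exists_bound hK
  obtain ⟨q, hq, hqR⟩ := exists_far hp.2 (2 * R)
  have ho : IsOpen (connectedComponentIn Kᶜ p) := hK.isClosed.isOpen_compl.connectedComponentIn
  have hc : IsConnected (connectedComponentIn Kᶜ p) :=
    ⟨⟨p, mem_connectedComponentIn hp.1⟩, isPreconnected_connectedComponentIn⟩
  obtain ⟨γ, hγ⟩ := (ho.isConnected_iff_isPathConnected.1 hc).joinedIn q hq p
    (mem_connectedComponentIn hp.1)
  exact hasLog_of_path γ (fun t => connectedComponentIn_subset _ _ (hγ t)) (hasLog_far hR hqR hR0)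

/-- Janiszewski's theorem. -/
lemma mem_ext_union {K K' : Set (ℝ × ℝ)} (hK : IsCompact K) (hK' : IsCompact K')
    (hc : IsPreconnected (K ∩ K')) {p : ℝ × ℝ} (hp : p ∈ ext K) (hp' : p ∈ ext K') :
    p ∈ ext (K ∪ K') :=
  mem_ext_of_hasLog (hK.union hK').isClosed (fun h => h.elim hp.1 hp'.1)
    (HasLog.glue hK.isClosed hK'.isClosed hc (hasLog_of_mem_ext hK hp) (hasLog_of_mem_ext hK' hp'))

lemma ext_anti {K K' : Set (ℝ × ℝ)} (h : K ⊆ K') : ext K' ⊆ ext K := by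
  intro p hp
  exact ⟨fun hk => hp.1 (h hk), fun hb => hp.2 (hb.subset
    (connectedComponentIn_mono p (compl_subset_compl.2 h)))⟩

lemma ext_comp {K : Set (ℝ × ℝ)} {p q : ℝ × ℝ} (hp : p ∈ ext K)
    (hq : q ∈ connectedComponentIn Kᶜ p) : q ∈ ext K :=
  ⟨connectedComponentIn_subset _ _ hq, by rw [← connectedComponentIn_eq hq]; exact hp.2⟩

/-- Connected sets missing `K` and meeting the exterior lie in the exterior. -/
lemma subset_ext {K S : Set (ℝ × ℝ)} (hS : IsPreconnected S) (hd : ∀ s ∈ S, s ∉ K)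
    (hm : (S ∩ ext K).Nonempty) : S ⊆ ext K := by
  obtain ⟨x, hx, hxe⟩ := hm
  intro y hy
  exact ext_comp hxe (hS.subset_connectedComponentIn hx hd hy)

lemma isOpen_ext {K : Set (ℝ × ℝ)} (hK : IsClosed K) : IsOpen (ext K) := by
  rw [isOpen_iff_mem_nhds]
  intro p hp
  exact Filter.mem_of_superset (hK.isOpen_compl.connectedComponentIn.mem_nhds
    (mem_connectedComponentIn hp.1)) (fun q hq => ext_comp hp hq)

lemma frontier_ext_subset {K : Set (ℝ × ℝ)} (hK : IsClosed K) : frontier (ext K) ⊆ K := by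
  intro x hx
  by_contra hxK
  rw [(isOpen_ext hK).frontier_eq] at hx
  have ho : IsOpen (connectedComponentIn Kᶜ x) := hK.isOpen_compl.connectedComponentIn
  obtain ⟨y, hy1, hy2⟩ := mem_closure_iff.1 hx.1 _ ho (mem_connectedComponentIn hxK)
  exact hx.2 (ext_comp hy2 (by
    rw [← connectedComponentIn_eq hy1]; exact mem_connectedComponentIn hxK))

/-- A point not separated from infinity by the frontier of the exterior is in the exterior. -/
lemma mem_ext_of_hasLog_frontier {Z : Set (ℝ × ℝ)} (hZ : IsCompact Z) {p : ℝ × ℝ}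
    (hp : p ∉ frontier (ext Z)) (h : HasLog (fun z => toC z - toC p) (frontier (ext Z))) :
    p ∈ ext Z := by
  have hpx := mem_ext_of_hasLog isClosed_frontier hp h
  obtain ⟨R, hR0, hR⟩ := exists_bound hZ
  obtain ⟨q, hq, hqR⟩ := exists_far hpx.2 (2 * R)
  have hqZ : q ∉ Z := fun hqZ => by linarith [hR q hqZ]
  have hqe : q ∈ ext Z := mem_ext_of_hasLog hZ.isClosed hqZ (hasLog_far hR hqR hR0)
  exact subset_of_frontier isPreconnected_connectedComponentIn (isOpen_ext hZ.isClosed)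
    ⟨q, hq, hqe⟩ (fun y hy => connectedComponentIn_subset _ _ hy) (mem_connectedComponentIn hp)

lemma isPreconnected_far {R : ℝ} (hR : 0 ≤ R) : IsPreconnected {z : ℝ × ℝ | R < ‖z‖} := by
  have h1 : IsPreconnected ({0}ᶜ : Set (ℝ × ℝ)) :=
    (isConnected_compl_singleton_of_one_lt_rank (by
      simp only [rank_prod', Module.rank_self]; norm_num [one_add_one_eq_two]) 0).isPreconnected
  have h2 := h1.image (fun z => (1 + R / ‖z‖) • z) (by
    intro z hz
    have : ‖z‖ ≠ 0 := norm_ne_zero_iff.2 hz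
    apply ContinuousAt.continuousWithinAt
    fun_prop (disch := assumption))
  convert h2 using 1
  ext w
  simp only [mem_ofPred_eq, mem_image, mem_compl_iff, mem_singleton_iff]
  constructor
  · intro hw
    have hw0 : 0 < ‖w‖ := hR.trans_lt hw
    have hk : 0 < 1 - R / ‖w‖ := by
      rw [sub_pos, div_lt_one hw0]; exact hw
    refine ⟨(1 - R / ‖w‖) • w, ?_, ?_⟩
    · exact smul_ne_zero hk.ne' (norm_ne_zero_iff.1 hw0.ne')
    · rw [norm_smul, Real.norm_eq_abs, abs_of_pos hk, smul_smul]
      have : (1 + R / ((1 - R / ‖w‖) * ‖w‖)) * (1 - R / ‖w‖) = 1 := by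
        have : ‖w‖ - R ≠ 0 := by linarith
        have e : (1 - R / ‖w‖) * ‖w‖ = ‖w‖ - R := by field_simp
        rw [e]
        field_simp
        ring
      rw [this, one_smul]
  · rintro ⟨z, hz, rfl⟩
    have hz0 : 0 < ‖z‖ := norm_pos_iff.2 hz
    have : 0 ≤ R / ‖z‖ := by positivity
    rw [norm_smul, Real.norm_eq_abs, abs_of_pos (by linarith), add_mul, div_mul_cancel₀ _ hz0.ne']
    linarith

lemma isPreconnected_ext {K : Set (ℝ × ℝ)} (hK : IsCompact K) : IsPreconnected (ext K) := by
  obtain ⟨R, hR0, hR⟩ := exists_bound hK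
  have hfar : ∀ q : ℝ × ℝ, R < ‖q‖ → q ∉ K := fun q hq hqK => by linarith [hR q hqK]
  apply isPreconnected_of_forall_pair
  intro x hx y hy
  obtain ⟨q, hq, hqR⟩ := exists_far hx.2 R
  obtain ⟨q', hq', hqR'⟩ := exists_far hy.2 R
  have hsub : {z : ℝ × ℝ | R < ‖z‖} ⊆ connectedComponentIn Kᶜ q :=
    (isPreconnected_far hR0).subset_connectedComponentIn hqR (fun z hz => hfar z hz)
  have e1 := connectedComponentIn_eq hq
  have e2 := connectedComponentIn_eq hq'
  have e3 := connectedComponentIn_eq (hsub hqR')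
  refine ⟨connectedComponentIn Kᶜ x, fun z hz => ext_comp hx hz, mem_connectedComponentIn hx.1, ?_,
    isPreconnected_connectedComponentIn⟩
  rw [e1, e3, ← e2]
  exact mem_connectedComponentIn hy.1

end PlaneTop

namespace PlaneTop

/-- `A` is a simple arc from `a` to `b`. -/
def IsArc (A : Set (ℝ × ℝ)) (a b : ℝ × ℝ) : Prop :=
  ∃ γ : Path a b, Function.Injective γ ∧ range γ = A

lemma hasLog_interval {h : unitInterval → ℂ} {S : Set unitInterval} (hS : S.OrdConnected)
    (hc : ContinuousOn h S) (hn : ∀ s ∈ S, h s ≠ 0) : HasLog h S := by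
  rcases S.eq_empty_or_nonempty with rfl | ⟨s₀, hs₀⟩
  · exact ⟨0, continuousOn_empty _, by simp⟩
  let c : unitInterval → unitInterval → unitInterval := fun t s =>
    projIcc (0 : ℝ) 1 zero_le_one ((s₀ : ℝ) + (t : ℝ) * ((s : ℝ) - s₀))
  have hcS : ∀ t, ∀ s ∈ S, c t s ∈ S := by
    intro t s hs
    have key : min (s₀ : ℝ) s ≤ (s₀ : ℝ) + (t : ℝ) * ((s : ℝ) - s₀) ∧
        (s₀ : ℝ) + (t : ℝ) * ((s : ℝ) - s₀) ≤ max (s₀ : ℝ) s := by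
      have t0 := t.2.1
      have t1 := t.2.2
      rcases le_total (s₀ : ℝ) s with h | h
      · rw [min_eq_left h, max_eq_right h]; constructor <;> nlinarith
      · rw [min_eq_right h, max_eq_left h]; constructor <;> nlinarith
    have hmem : (s₀ : ℝ) + (t : ℝ) * ((s : ℝ) - s₀) ∈ Icc (0:ℝ) 1 :=
      ⟨le_trans (le_min s₀.2.1 s.2.1) key.1, key.2.trans (max_le s₀.2.2 s.2.2)⟩
    have e : c t s = ⟨_, hmem⟩ := projIcc_of_mem zero_le_one hmem
    rcases le_total s₀ s with h | h
    · have h' : (s₀ : ℝ) ≤ s := h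
      rw [min_eq_left h', max_eq_right h'] at key
      exact hS.out hs₀ hs (by rw [e]; exact key)
    · have h' : (s : ℝ) ≤ s₀ := h
      rw [min_eq_right h', max_eq_left h'] at key
      exact hS.out hs hs₀ (by rw [e]; exact key)
  have hcc : Continuous (fun q : unitInterval × unitInterval => c q.1 q.2) := by
    refine continuous_projIcc.comp ?_
    fun_prop
  have e0 : ∀ s, c 0 s = s₀ := by
    intro s; simp [c]
  have e1 : ∀ s, c 1 s = s := by
    intro s; simp [c]
  have := HasLog.lift (K := S) (fun t s => h (c t s))
    (hc.comp hcc.continuousOn (fun q hq => hcS q.1 q.2 hq.2))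
    (fun t s hs => hn _ (hcS t s hs)) (by simp only [e0]; exact HasLog.const (hn _ hs₀))
  simpa only [e1] using this

lemma hasLog_image {γ : unitInterval → ℝ × ℝ} (hγ : Continuous γ) (hi : Function.Injective γ)
    {S : Set unitInterval} (hS : S.OrdConnected) {f : ℝ × ℝ → ℂ} (hc : ContinuousOn f (γ '' S))
    (hn : ∀ s ∈ S, f (γ s) ≠ 0) : HasLog f (γ '' S) := by
  obtain ⟨l, h1, h2⟩ := hasLog_interval (h := fun s => f (γ s)) hS
    (hc.comp hγ.continuousOn (mapsTo_image γ S)) hn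
  have hemb : Topology.IsClosedEmbedding γ := hγ.isClosedEmbedding hi
  have hl : Function.LeftInverse (Function.invFun γ) γ := Function.leftInverse_invFun hi
  refine ⟨fun z => l (Function.invFun γ z), ?_, ?_⟩
  · have hinv : ContinuousOn (Function.invFun γ) (range γ) := by
      rw [continuousOn_iff_continuous_domRestrict]
      have : (range γ).domRestrict (Function.invFun γ) = hemb.isEmbedding.toHomeomorph.symm := by
        funext ⟨_, t, rfl⟩
        have e : (⟨γ t, mem_range_self t⟩ : range γ) = hemb.isEmbedding.toHomeomorph t := rfl
        rw [e, Homeomorph.symm_apply_apply]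
        exact hl t
      rw [this]
      exact Homeomorph.continuous _
    refine h1.comp (hinv.mono (image_subset_range _ _)) ?_
    rintro _ ⟨t, ht, rfl⟩
    rw [hl t]; exact ht
  · rintro _ ⟨t, ht, rfl⟩
    simp only [hl t, h2 t ht]

lemma toC_sub_continuous (p : ℝ × ℝ) : Continuous (fun z => toC z - toC p) :=
  toC_continuous.sub continuous_const

namespace IsArc
variable {A B Q : Set (ℝ × ℝ)} {a b m : ℝ × ℝ}

lemma compact (h : IsArc A a b) : IsCompact A := by
  obtain ⟨γ, -, rfl⟩ := h
  exact isCompact_range γ.continuous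

lemma preconnected (h : IsArc A a b) : IsPreconnected A := by
  obtain ⟨γ, -, rfl⟩ := h
  exact isPreconnected_range γ.continuous

lemma left_mem (h : IsArc A a b) : a ∈ A := by
  obtain ⟨γ, -, rfl⟩ := h
  exact ⟨0, γ.source⟩

lemma right_mem (h : IsArc A a b) : b ∈ A := by
  obtain ⟨γ, -, rfl⟩ := h
  exact ⟨1, γ.target⟩

lemma ne (h : IsArc A a b) : a ≠ b := by
  obtain ⟨γ, hi, rfl⟩ := h
  intro e
  have := hi (γ.source.trans (e.trans γ.target.symm))
  exact zero_ne_one this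

lemma symm (h : IsArc A a b) : IsArc A b a := by
  obtain ⟨γ, hi, rfl⟩ := h
  refine ⟨γ.symm, ?_, γ.symm_range⟩
  intro s t hst
  exact unitInterval.symm_bijective.injective (hi hst)

lemma hasLog (h : IsArc A a b) {p : ℝ × ℝ} (hp : p ∉ A) : HasLog (fun z => toC z - toC p) A := by
  obtain ⟨γ, hi, rfl⟩ := h
  have := hasLog_image (S := univ) γ.continuous hi ordConnected_univ
    (toC_sub_continuous p).continuousOn
    (fun s _ => toC_sub_ne (fun e => hp ⟨s, e⟩))
  rwa [image_univ] at this

lemma interior_eq {γ : Path a b} (hi : Function.Injective γ) :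
    range γ \ {a, b} = γ '' Ioo 0 1 := by
  ext x
  constructor
  · rintro ⟨⟨t, rfl⟩, h⟩
    simp only [mem_insert_iff, mem_singleton_iff, not_or] at h
    refine ⟨t, ⟨unitInterval.pos_iff_ne_zero.2 ?_, unitInterval.lt_one_iff_ne_one.2 ?_⟩, rfl⟩
    · rintro rfl; exact h.1 γ.source
    · rintro rfl; exact h.2 γ.target
  · rintro ⟨t, ht, rfl⟩
    refine ⟨mem_range_self t, ?_⟩
    simp only [mem_insert_iff, mem_singleton_iff, not_or]
    constructor
    · intro h; exact ht.1.ne' (hi (h.trans γ.source.symm))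
    · intro h; exact ht.2.ne (hi (h.trans γ.target.symm))

lemma interior_preconnected (h : IsArc A a b) : IsPreconnected (A \ {a, b}) := by
  obtain ⟨γ, hi, rfl⟩ := h
  rw [interior_eq hi]
  exact isPreconnected_Ioo.image _ γ.continuous.continuousOn

lemma interior_nonempty (h : IsArc A a b) : (A \ {a, b}).Nonempty := by
  obtain ⟨γ, hi, rfl⟩ := h
  rw [interior_eq hi]
  exact (nonempty_Ioo.2 zero_lt_one).image _

lemma trans (h : IsArc A a m) (h' : IsArc B m b) (hd : A ∩ B ⊆ {m}) : IsArc (A ∪ B) a b := by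
  obtain ⟨γ, hi, rfl⟩ := h
  obtain ⟨δ, hj, rfl⟩ := h'
  refine ⟨γ.trans δ, ?_, Path.trans_range γ δ⟩
  have key : ∀ s t : unitInterval, (s : ℝ) ≤ 1 / 2 → ¬ (t : ℝ) ≤ 1 / 2 →
      (γ.trans δ) s ≠ (γ.trans δ) t := by
    intro s t hs ht e
    rw [Path.trans_apply, Path.trans_apply, dif_pos hs, dif_neg ht] at e
    have hm := hd ⟨⟨_, e⟩, ⟨_, rfl⟩⟩
    have := hj (hm.trans δ.source.symm)
    have := congrArg Subtype.val this
    push Not at ht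
    have this : 2 * (t : ℝ) - 1 = 0 := this
    linarith
  intro s t e
  by_cases hs : (s : ℝ) ≤ 1 / 2
  · by_cases ht : (t : ℝ) ≤ 1 / 2
    · rw [Path.trans_apply, Path.trans_apply, dif_pos hs, dif_pos ht] at e
      have := congrArg Subtype.val (hi e)
      simp only at this
      exact Subtype.ext (by linarith)
    · exact absurd e (key s t hs ht)
  · by_cases ht : (t : ℝ) ≤ 1 / 2
    · exact absurd e.symm (key t s ht hs)
    · rw [Path.trans_apply, Path.trans_apply, dif_neg hs, dif_neg ht] at e
      have := congrArg Subtype.val (hj e)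
      simp only at this
      exact Subtype.ext (by linarith)

/-- dual logarithm on the complement of a connected set. -/
lemma hasLog_compl (h : IsArc A a b) :
    HasLog (fun z => (toC z - toC a) / (toC z - toC b)) Aᶜ := by
  obtain ⟨γ, hi, rfl⟩ := h
  have hnm : ∀ t, ∀ z ∈ (range γ)ᶜ, toC z - toC (γ t) ≠ 0 := fun t z hz =>
    toC_sub_ne (fun e => hz ⟨t, e.symm⟩)
  have hna : ∀ z ∈ (range γ)ᶜ, toC z - toC a ≠ 0 := fun z hz => by
    have := hnm 0 z hz
    rwa [γ.source] at this
  have := HasLog.lift (K := (range γ)ᶜ) (fun t z => (toC z - toC a) / (toC z - toC (γ t)))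
    (by
      have := toC_continuous
      apply ContinuousOn.div
      · fun_prop
      · fun_prop
      · rintro ⟨t, z⟩ ⟨-, hz⟩
        exact hnm t z hz)
    (fun t z hz => div_ne_zero (hna z hz) (hnm t z hz))
    ((HasLog.const one_ne_zero).congr (fun z hz => by
      rw [γ.source, div_self (hna z hz)]))
  simpa using this

/-- A simple closed curve separates the plane. -/
lemma exists_enclosed (hA : IsArc A a b) (hB : IsArc B a b) (hd : A ∩ B ⊆ {a, b}) :
    ∃ p, p ∉ A ∪ B ∧ p ∉ ext (A ∪ B) := by
  by_contra hcon
  push Not at hcon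
  have he : ext (A ∪ B) = (A ∪ B)ᶜ := by
    ext p
    exact ⟨fun h => h.1, fun h => hcon p h⟩
  have hpc : IsPreconnected (Aᶜ ∩ Bᶜ) := by
    rw [← compl_union, ← he]
    exact isPreconnected_ext (hA.compact.union hB.compact)
  have hlog := HasLog.glue_open hA.compact.isClosed.isOpen_compl hB.compact.isClosed.isOpen_compl
    hpc hA.hasLog_compl hB.hasLog_compl
  have hab : toC a - toC b ≠ 0 := toC_sub_ne hA.ne
  set r := ‖toC a - toC b‖ / 2 with hr
  have hr0 : 0 < r := by
    have := norm_pos_iff.2 hab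
    positivity
  have hnorm : ∀ z ∈ range (circ a r), ‖toC z - toC a‖ = r := by
    rintro _ ⟨θ, rfl⟩
    rw [toC_circ, norm_mul, Complex.norm_exp_ofReal_mul_I, mul_one, Complex.norm_real,
      Real.norm_eq_abs, abs_of_pos hr0]
  have hF : ∀ t : unitInterval, ∀ z ∈ range (circ a r),
      toC a + ((t : ℝ) : ℂ) * (toC z - toC a) - toC b ≠ 0 := by
    intro t z hz h
    have e : toC a - toC b = -(((t : ℝ) : ℂ) * (toC z - toC a)) := by
      linear_combination h
    have e' := congrArg norm e
    rw [norm_neg, norm_mul, hnorm z hz, Complex.norm_real, Real.norm_eq_abs,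
      abs_of_nonneg t.2.1] at e'
    have : (t : ℝ) * r ≤ 1 * r := mul_le_mul_of_nonneg_right t.2.2 hr0.le
    have : ‖toC a - toC b‖ = 2 * r := by rw [hr]; ring
    linarith
  have hb : HasLog (fun z => toC z - toC b) (range (circ a r)) := by
    have := HasLog.lift (K := range (circ a r))
      (fun t z => toC a + ((t : ℝ) : ℂ) * (toC z - toC a) - toC b)
      (by have := toC_continuous; fun_prop) hF
      (by simpa using HasLog.const hab)
    simpa using this
  have hnb : ∀ z ∈ range (circ a r), toC z - toC b ≠ 0 := by
    intro z hz
    have := hF 1 z hz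
    simpa using this
  apply not_hasLog_circ a hr0
  refine ((hlog.mono ?_).mul hb).congr ?_
  · intro z hz
    rw [← compl_inter]
    intro hz'
    rcases hd hz' with e | e
    · have := hnorm z hz
      rw [e] at this
      simp at this
      linarith
    · exact hnb z hz (by rw [e, sub_self])
  · intro z hz
    exact div_mul_cancel₀ _ (hnb z hz)

lemma hasLog_proper (hA : IsArc A a b) (hB : IsArc B a b) (hd : A ∩ B ⊆ {a, b})
    {X : Set (ℝ × ℝ)} (hX : IsClosed X) (hXs : X ⊆ A ∪ B) {x₀ : ℝ × ℝ} (hx₀ : x₀ ∈ A)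
    (hx₀X : x₀ ∉ X) {p : ℝ × ℝ} (hp : p ∉ A ∪ B) : HasLog (fun z => toC z - toC p) X := by
  obtain ⟨γ, hi, rfl⟩ := id hA
  obtain ⟨t₀, rfl⟩ := hx₀
  have hsub : ∀ S : Set unitInterval, S.OrdConnected →
      HasLog (fun z => toC z - toC p) (X ∩ γ '' S) := fun S hS =>
    (hasLog_image γ.continuous hi hS (toC_sub_continuous p).continuousOn
      (fun s _ => toC_sub_ne (fun e => hp (Or.inl ⟨s, e⟩)))).mono inter_subset_right
  have hcl : ∀ S : Set unitInterval, IsClosed S → IsClosed (X ∩ γ '' S) := fun S hS =>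
    hX.inter (hS.isCompact.image γ.continuous).isClosed
  have hb := hB.hasLog (p := p) (fun h => hp (Or.inr h))
  have h1 := HasLog.glue hB.compact.isClosed (hcl (Iic t₀) isClosed_Iic) (by
    apply Subsingleton.isPreconnected
    have : B ∩ (X ∩ γ '' Iic t₀) ⊆ {a} := by
      rintro z ⟨hzB, hzX, t, ht, rfl⟩
      rcases hd ⟨mem_range_self t, hzB⟩ with e | e
      · exact e
      · exfalso
        have : t = 1 := hi (e.trans γ.target.symm)
        subst this
        have : t₀ = 1 := le_antisymm unitInterval.le_one' ht
        subst this
        exact hx₀X hzX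
    exact subsingleton_singleton.anti this) hb (hsub _ ordConnected_Iic)
  have h2 := HasLog.glue (hB.compact.isClosed.union (hcl (Iic t₀) isClosed_Iic))
    (hcl (Ici t₀) isClosed_Ici) (by
    apply Subsingleton.isPreconnected
    have : (B ∪ (X ∩ γ '' Iic t₀)) ∩ (X ∩ γ '' Ici t₀) ⊆ {b} := by
      rintro z ⟨hz, hzX, t, ht, rfl⟩
      rcases hz with hzB | ⟨-, s, hs, hst⟩
      · rcases hd ⟨mem_range_self t, hzB⟩ with e | e
        · exfalso
          have : t = 0 := hi (e.trans γ.source.symm)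
          subst this
          have : t₀ = 0 := le_antisymm ht unitInterval.nonneg'
          subst this
          exact hx₀X hzX
        · exact e
      · have : s = t := hi hst
        subst this
        have : s = t₀ := le_antisymm hs ht
        subst this
        exact absurd hzX hx₀X
    exact subsingleton_singleton.anti this) h1 (hsub _ ordConnected_Ici)
  refine h2.mono ?_
  intro z hz
  rcases hXs hz with ⟨t, rfl⟩ | h
  · rcases le_total t t₀ with h | h
    · exact Or.inl (Or.inr ⟨hz, t, h, rfl⟩)
    · exact Or.inr ⟨hz, t, h, rfl⟩
  · exact Or.inl (Or.inl h)

/-- The exterior of a simple closed curve is bounded by the whole curve. -/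
lemma frontier_ext (hA : IsArc A a b) (hB : IsArc B a b) (hd : A ∩ B ⊆ {a, b}) :
    frontier (ext (A ∪ B)) = A ∪ B := by
  have hZ := hA.compact.union hB.compact
  apply Subset.antisymm (frontier_ext_subset hZ.isClosed)
  intro x hx
  by_contra hxX
  obtain ⟨p, hp1, hp2⟩ := exists_enclosed hA hB hd
  apply hp2
  apply mem_ext_of_hasLog_frontier hZ (fun h => hp1 (frontier_ext_subset hZ.isClosed h))
  rcases hx with hx | hx
  · exact hasLog_proper hA hB hd isClosed_frontier (frontier_ext_subset hZ.isClosed) hx hxX hp1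
  · refine hasLog_proper hB hA (inter_comm A B ▸ hd) isClosed_frontier ?_ hx hxX
      (union_comm A B ▸ hp1)
    rw [union_comm B A]
    exact frontier_ext_subset hZ.isClosed

lemma theta_aux (hA : IsArc A a b) (hBc : IsCompact B) (hQc : IsCompact Q)
    (hB : IsPreconnected (B \ {a, b}))
    (hAB : A ∩ B ⊆ {a, b}) (hBQ : B ∩ Q ⊆ {a, b})
    (hQ : Q \ {a, b} ⊆ ext (A ∪ B)) (hm : (B ∩ ext (A ∪ Q)).Nonempty)
    {p : ℝ × ℝ} (hp : p ∉ A ∪ B) (hpe : p ∉ ext (A ∪ B)) (hab : a ∈ A ∧ b ∈ A) :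
    p ∈ ext (A ∪ Q) := by
  have hBe : B \ {a, b} ⊆ ext (A ∪ Q) := by
    apply subset_ext hB
    · rintro s ⟨hsB, hs⟩ (h | h)
      · exact hs (hAB ⟨h, hsB⟩)
      · exact hs (hBQ ⟨hsB, h⟩)
    · obtain ⟨x, hxB, hx⟩ := hm
      refine ⟨x, ⟨hxB, ?_⟩, hx⟩
      rintro (rfl | rfl)
      · exact hx.1 (Or.inl hab.1)
      · exact hx.1 (Or.inl hab.2)
  have hWQ : ∀ z ∈ connectedComponentIn (A ∪ B)ᶜ p, z ∉ Q := by
    intro z hz hzQ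
    have hzn := connectedComponentIn_subset _ _ hz
    have : z ∈ ext (A ∪ B) := hQ ⟨hzQ, by
      rintro (rfl | rfl)
      · exact hzn (Or.inl hab.1)
      · exact hzn (Or.inl hab.2)⟩
    apply hpe
    apply ext_comp this
    rw [← connectedComponentIn_eq hz]
    exact mem_connectedComponentIn hp
  have hpW : p ∈ connectedComponentIn (A ∪ B)ᶜ p := mem_connectedComponentIn hp
  have hpn : p ∉ A ∪ Q := by
    rintro (h | h)
    · exact hp (Or.inl h)
    · exact hWQ p hpW h
  refine ⟨hpn, fun hb => ?_⟩
  set W' := connectedComponentIn (A ∪ Q)ᶜ p with hW'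
  have hpW' : p ∈ W' := mem_connectedComponentIn hpn
  have hW'B : ∀ z ∈ W', z ∉ B := by
    intro z hz hzB
    have hzn := connectedComponentIn_subset _ _ hz
    have : z ∈ ext (A ∪ Q) := hBe ⟨hzB, by
      rintro (rfl | rfl)
      · exact hzn (Or.inl hab.1)
      · exact hzn (Or.inl hab.2)⟩
    apply this.2
    rw [← connectedComponentIn_eq hz]
    exact hb
  have e : W' = connectedComponentIn (A ∪ B)ᶜ p := by
    apply Subset.antisymm
    · apply isPreconnected_connectedComponentIn.subset_connectedComponentIn hpW'
      rintro z hz (h | h)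
      · exact connectedComponentIn_subset _ _ hz (Or.inl h)
      · exact hW'B z hz h
    · apply isPreconnected_connectedComponentIn.subset_connectedComponentIn hpW
      rintro z hz (h | h)
      · exact connectedComponentIn_subset _ _ hz (Or.inl h)
      · exact hWQ z hz h
  have f1 : frontier W' ⊆ A ∪ Q := frontier_comp_subset (hA.compact.union hQc).isClosed p
  have f2 : frontier W' ⊆ A ∪ B := by
    rw [e]; exact frontier_comp_subset (hA.compact.union hBc).isClosed p
  have f3 : frontier W' ⊆ A := by
    intro z hz
    rcases f1 hz with h | h
    · exact h
    rcases f2 hz with h' | h'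
    · exact h'
    rcases hBQ ⟨h', h⟩ with rfl | rfl
    · exact hab.1
    · exact hab.2
  have hpA : p ∉ A := fun h => hp (Or.inl h)
  have := mem_ext_of_hasLog hA.compact.isClosed hpA (hA.hasLog hpA)
  apply this.2
  apply hb.subset
  apply subset_of_frontier isPreconnected_connectedComponentIn
    (hA.compact.union hQc).isClosed.isOpen_compl.connectedComponentIn
    ⟨p, mem_connectedComponentIn hpA, hpW'⟩
  intro y hy hyf
  exact connectedComponentIn_subset _ _ hy (f3 hyf)

/-- The theta lemma: adding an ear `Q` in the exterior of a closed curve `A ∪ B`, one of the two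
new closed curves encloses everything. -/
lemma theta (hA : IsArc A a b) (hB : IsArc B a b) (hQ : IsArc Q a b)
    (hAB : A ∩ B ⊆ {a, b}) (hAQ : A ∩ Q ⊆ {a, b}) (hBQ : B ∩ Q ⊆ {a, b})
    (he : Q \ {a, b} ⊆ ext (A ∪ B)) :
    ext (A ∪ Q) ⊆ ext (A ∪ B) ∨ ext (B ∪ Q) ⊆ ext (A ∪ B) := by
  by_cases h1 : (B ∩ ext (A ∪ Q)).Nonempty
  swap
  · left
    intro x hx
    refine ⟨fun h => h.elim (fun h => hx.1 (Or.inl h)) (fun h => h1 ⟨x, h, hx⟩), fun hb => ?_⟩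
    apply hx.2
    apply hb.subset
    apply isPreconnected_connectedComponentIn.subset_connectedComponentIn
      (mem_connectedComponentIn hx.1)
    rintro y hy (h | h)
    · exact connectedComponentIn_subset _ _ hy (Or.inl h)
    · exact h1 ⟨y, h, ext_comp hx hy⟩
  by_cases h2 : (A ∩ ext (B ∪ Q)).Nonempty
  swap
  · right
    intro x hx
    refine ⟨fun h => h.elim (fun h => h2 ⟨x, h, hx⟩) (fun h => hx.1 (Or.inl h)), fun hb => ?_⟩
    apply hx.2
    apply hb.subset
    apply isPreconnected_connectedComponentIn.subset_connectedComponentIn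
      (mem_connectedComponentIn hx.1)
    rintro y hy (h | h)
    · exact h2 ⟨y, h, ext_comp hx hy⟩
    · exact connectedComponentIn_subset _ _ hy (Or.inl h)
  exfalso
  obtain ⟨p, hp1, hp2⟩ := exists_enclosed hA hB hAB
  have q1 := theta_aux hA hB.compact hQ.compact hB.interior_preconnected hAB hBQ he h1 hp1 hp2
    ⟨hA.left_mem, hA.right_mem⟩
  have q2 := theta_aux (A := B) (B := A) hB hA.compact hQ.compact hA.interior_preconnected
    (inter_comm A B ▸ hAB) hAQ (union_comm A B ▸ he) h2 (union_comm A B ▸ hp1)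
    (union_comm A B ▸ hp2) ⟨hB.left_mem, hB.right_mem⟩
  have q3 := mem_ext_union (hA.compact.union hQ.compact) (hB.compact.union hQ.compact) (by
    rw [← inter_union_distrib_right]
    have : A ∩ B ∪ Q = Q := by
      apply union_eq_right.2
      intro z hz
      rcases hAB hz with rfl | rfl
      · exact hQ.left_mem
      · exact hQ.right_mem
    rw [this]
    exact hQ.preconnected) q1 q2
  exact hp2 (ext_anti (by
    rintro z (h | h)
    · exact Or.inl (Or.inl h)
    · exact Or.inr (Or.inl h)) q3)

end IsArc
end PlaneTop

namespace PlaneTop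
open SimpleGraph

section
variable {V : Type} {G : SimpleGraph V} (D : Drawing G)

lemma outerFace_eq : D.outerFace = ext D.graphSet := rfl

lemma arcSet_isArc {u v : V} (h : G.Adj u v) : IsArc (D.arcSet h) (D.pos u) (D.pos v) :=
  ⟨D.arc h, D.arc_inj h, rfl⟩

lemma arcSet_symm {u v : V} (h : G.Adj u v) : D.arcSet h.symm = D.arcSet h := by
  unfold Drawing.arcSet
  rw [D.arc_symm h, Path.symm_range]

lemma arcSet_congr {u v x y : V} (h : G.Adj u v) (h' : G.Adj x y) (e : s(u, v) = s(x, y)) :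
    D.arcSet h = D.arcSet h' := by
  rcases Sym2.eq_iff.1 e with ⟨rfl, rfl⟩ | ⟨rfl, rfl⟩
  · rfl
  · exact arcSet_symm D h'

lemma mem_arcSet_pos {u v w : V} (h : G.Adj u v) (hw : D.pos w ∈ D.arcSet h) : w = u ∨ w = v := by
  obtain ⟨t, ht⟩ := hw
  rcases D.arc_vertex h t w ht with rfl | rfl
  · left; exact D.pos_inj (ht.symm.trans (D.arc h).source)
  · right; exact D.pos_inj (ht.symm.trans (D.arc h).target)

lemma mem_arcSet_cases {u v : V} (h : G.Adj u v) {p : ℝ × ℝ} (hp : p ∈ D.arcSet h) :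
    p = D.pos u ∨ p = D.pos v ∨ p ∈ D.arcInterior h := by
  obtain ⟨t, rfl⟩ := hp
  by_cases h0 : t = 0
  · left; rw [h0]; exact (D.arc h).source
  by_cases h1 : t = 1
  · right; left; rw [h1]; exact (D.arc h).target
  · right; right; exact ⟨t, ⟨h0, h1⟩, rfl⟩

variable {D} in
lemma arc_inter (hD : D.IsPlane) {u v x y : V} (h : G.Adj u v) (h' : G.Adj x y)
    (hne : s(u, v) ≠ s(x, y)) {p : ℝ × ℝ} (hp : p ∈ D.arcSet h) (hp' : p ∈ D.arcSet h') :
    ∃ w, p = D.pos w ∧ (w = u ∨ w = v) ∧ (w = x ∨ w = y) := by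
  rcases mem_arcSet_cases D h hp with rfl | rfl | hi
  · exact ⟨u, rfl, Or.inl rfl, mem_arcSet_pos D h' hp'⟩
  · exact ⟨v, rfl, Or.inr rfl, mem_arcSet_pos D h' hp'⟩
  rcases mem_arcSet_cases D h' hp' with rfl | rfl | hi'
  · exact ⟨x, rfl, mem_arcSet_pos D h hp, Or.inl rfl⟩
  · exact ⟨y, rfl, mem_arcSet_pos D h hp, Or.inr rfl⟩
  exact absurd ⟨u, v, x, y, h, h', hne, hi, hi'⟩ (hD p)

lemma arcSet_subset {u v : V} (h : G.Adj u v) : D.arcSet h ⊆ D.graphSet := by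
  intro p hp
  right
  simp only [mem_iUnion]
  exact ⟨u, v, h, hp⟩

lemma pos_mem (v : V) : D.pos v ∈ D.graphSet := Or.inl ⟨v, rfl⟩

lemma graphSet_compact [Finite V] : IsCompact D.graphSet := by
  apply IsCompact.union (finite_range _).isCompact
  refine isCompact_iUnion fun u => isCompact_iUnion fun v => ?_
  by_cases h : G.Adj u v
  · simpa [h] using (arcSet_isArc D h).compact
  · simp [h]

lemma mem_walkSet {a b : V} {W : G.Walk a b} {p : ℝ × ℝ} :
    p ∈ D.walkSet W ↔ (∃ v ∈ W.support, p = D.pos v) ∨ ∃ d ∈ W.darts, p ∈ D.arcSet d.adj := by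
  unfold Drawing.walkSet
  constructor
  · rintro (⟨v, hv, rfl⟩ | h)
    · exact Or.inl ⟨v, hv, rfl⟩
    · simp only [mem_iUnion] at h
      obtain ⟨d, hd, h⟩ := h
      exact Or.inr ⟨d, hd, h⟩
  · rintro (⟨v, hv, rfl⟩ | ⟨d, hd, h⟩)
    · exact Or.inl ⟨v, hv, rfl⟩
    · right
      simp only [mem_iUnion]
      exact ⟨d, hd, h⟩

lemma pos_mem_walkSet {a b : V} {W : G.Walk a b} {w : V} :
    D.pos w ∈ D.walkSet W ↔ w ∈ W.support := by
  rw [mem_walkSet]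
  constructor
  · rintro (⟨v, hv, e⟩ | ⟨d, hd, h⟩)
    · rwa [D.pos_inj e]
    · rcases mem_arcSet_pos D d.adj h with rfl | rfl
      · exact W.dart_fst_mem_support_of_mem_darts hd
      · exact W.dart_snd_mem_support_of_mem_darts hd
  · intro h; exact Or.inl ⟨w, h, rfl⟩

lemma walkSet_subset {a b : V} (W : G.Walk a b) : D.walkSet W ⊆ D.graphSet := by
  intro p hp
  rcases (mem_walkSet D).1 hp with ⟨v, hv, rfl⟩ | ⟨d, hd, h⟩
  · exact pos_mem D v
  · exact arcSet_subset D d.adj h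

lemma walkSet_mono {a b a' b' : V} {W : G.Walk a b} {W' : G.Walk a' b'}
    (h1 : W.support ⊆ W'.support) (h2 : W.darts ⊆ W'.darts) : D.walkSet W ⊆ D.walkSet W' := by
  intro p hp
  rw [mem_walkSet] at hp ⊢
  rcases hp with ⟨v, hv, e⟩ | ⟨d, hd, h⟩
  · exact Or.inl ⟨v, h1 hv, e⟩
  · exact Or.inr ⟨d, h2 hd, h⟩

@[simp] lemma walkSet_nil {a : V} : D.walkSet (Walk.nil : G.Walk a a) = {D.pos a} := by
  ext p; rw [mem_walkSet]; simp

lemma walkSet_cons {a b c : V} (h : G.Adj a b) (p : G.Walk b c) :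
    D.walkSet (Walk.cons h p) = D.arcSet h ∪ D.walkSet p := by
  ext x
  simp only [mem_union, mem_walkSet, Walk.support_cons, Walk.darts_cons, List.mem_cons]
  constructor
  · rintro (⟨v, rfl | hv, rfl⟩ | ⟨d, rfl | hd, h'⟩)
    · exact Or.inl (arcSet_isArc D h).left_mem
    · exact Or.inr (Or.inl ⟨v, hv, rfl⟩)
    · exact Or.inl h'
    · exact Or.inr (Or.inr ⟨d, hd, h'⟩)
  · rintro (h' | ⟨v, hv, rfl⟩ | ⟨d, hd, h'⟩)
    · exact Or.inr ⟨_, Or.inl rfl, h'⟩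
    · exact Or.inl ⟨v, Or.inr hv, rfl⟩
    · exact Or.inr ⟨d, Or.inr hd, h'⟩

lemma walkSet_append {a b c : V} (p : G.Walk a b) (q : G.Walk b c) :
    D.walkSet (p.append q) = D.walkSet p ∪ D.walkSet q := by
  ext x
  simp only [mem_union, mem_walkSet, Walk.mem_support_append_iff, Walk.darts_append, List.mem_append]
  grind

lemma walkSet_reverse {a b : V} (p : G.Walk a b) : D.walkSet p.reverse = D.walkSet p := by
  induction p with
  | nil => simp
  | cons h p ih =>
    rw [Walk.reverse_cons, walkSet_append, ih, walkSet_cons, walkSet_cons, arcSet_symm D h, walkSet_nil]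
    ext x
    have := (arcSet_isArc D h).left_mem
    simp only [mem_union, mem_singleton_iff]
    grind

variable {D} in
lemma walkSet_inter (hD : D.IsPlane) {a b a' b' : V} {W : G.Walk a b} {W' : G.Walk a' b'}
    (hd : ∀ e ∈ W.edges, e ∉ W'.edges) {p : ℝ × ℝ} (hp : p ∈ D.walkSet W) (hp' : p ∈ D.walkSet W') :
    ∃ w ∈ W.support, w ∈ W'.support ∧ p = D.pos w := by
  rcases (mem_walkSet D).1 hp with ⟨v, hv, rfl⟩ | ⟨d, hd1, h⟩
  · exact ⟨v, hv, (pos_mem_walkSet D).1 hp', rfl⟩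
  rcases (mem_walkSet D).1 hp' with ⟨v, hv, rfl⟩ | ⟨d', hd2, h'⟩
  · exact ⟨v, (pos_mem_walkSet D).1 hp, hv, rfl⟩
  have hne : s(d.fst, d.snd) ≠ s(d'.fst, d'.snd) := by
    intro e
    refine hd d.edge (List.mem_map_of_mem hd1) ?_
    have : d.edge = d'.edge := e
    rw [this]; exact List.mem_map_of_mem hd2
  obtain ⟨w, rfl, -, -⟩ := arc_inter hD d.adj d'.adj hne h h'
  exact ⟨w, (pos_mem_walkSet D).1 hp, (pos_mem_walkSet D).1 hp', rfl⟩

variable {D} in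
lemma path_isArc (hD : D.IsPlane) {a b : V} (W : G.Walk a b) (hW : W.IsPath) (hn : a ≠ b) :
    IsArc (D.walkSet W) (D.pos a) (D.pos b) := by
  induction W with
  | nil => exact absurd rfl hn
  | @cons u m b h p ih =>
    rw [walkSet_cons]
    rw [Walk.cons_isPath_iff] at hW
    by_cases hmb : m = b
    · subst hmb
      have : p = Walk.nil := (Walk.isPath_iff_nil.1 hW.1).eq_nil
      subst this
      have e : D.arcSet h ∪ D.walkSet (Walk.nil : G.Walk m m) = D.arcSet h := by
        rw [walkSet_nil]
        exact union_eq_left.2 (singleton_subset_iff.2 (arcSet_isArc D h).right_mem)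
      rw [e]; exact arcSet_isArc D h
    · refine (arcSet_isArc D h).trans (ih hW.1 hmb) ?_
      rintro x ⟨h1, h2⟩
      have h1' : x ∈ D.walkSet (Walk.cons h Walk.nil) := by
        rw [walkSet_cons]; exact Or.inl h1
      obtain ⟨w, hw1, hw2, rfl⟩ := walkSet_inter hD (by
        intro e he he'
        simp only [Walk.edges_cons, Walk.edges_nil, List.mem_singleton] at he
        subst he
        exact hW.2 (Walk.fst_mem_support_of_mem_edges p he')) h1' h2
      simp only [Walk.support_cons, Walk.support_nil, List.mem_cons, List.not_mem_nil, or_false] at hw1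
      rcases hw1 with rfl | rfl
      · exact absurd hw2 hW.2
      · rfl

/-- Restriction of a drawing along an injective graph homomorphism. -/
def comap {W : Type} {H : SimpleGraph W} (f : H →g G) (hf : Function.Injective f) : Drawing H where
  pos w := D.pos (f w)
  pos_inj := D.pos_inj.comp hf
  arc u v h := D.arc (f.map_adj h)
  arc_symm u v h := D.arc_symm (f.map_adj h)
  arc_inj u v h := D.arc_inj (f.map_adj h)
  arc_vertex u v h t w e := D.arc_vertex (f.map_adj h) t (f w) e
  arc_meet_once u v x y h₁ h₂ hne := D.arc_meet_once (f.map_adj h₁) (f.map_adj h₂) (by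
    intro e; exact hne (Sym2.map.injective hf e))
  arc_no_triple u₁ v₁ u₂ v₂ u₃ v₃ h₁ h₂ h₃ h12 h13 h23 p hp := by
    obtain ⟨w, rfl⟩ := D.arc_no_triple (f.map_adj h₁) (f.map_adj h₂) (f.map_adj h₃)
      (fun e => h12 (Sym2.map.injective hf e)) (fun e => h13 (Sym2.map.injective hf e))
      (fun e => h23 (Sym2.map.injective hf e)) p hp
    rcases mem_arcSet_pos D (f.map_adj h₁) hp.1.1 with rfl | rfl
    · exact ⟨u₁, rfl⟩
    · exact ⟨v₁, rfl⟩

section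
variable {W : Type} {H : SimpleGraph W} (f : H →g G) (hf : Function.Injective f)

@[simp] lemma comap_pos (w : W) : (comap D f hf).pos w = D.pos (f w) := rfl

lemma comap_plane (hD : D.IsPlane) : (comap D f hf).IsPlane := by
  rintro p ⟨u, v, x, y, h₁, h₂, hne, hp, hp'⟩
  exact hD p ⟨f u, f v, f x, f y, f.map_adj h₁, f.map_adj h₂,
    fun e => hne (Sym2.map.injective hf e), hp, hp'⟩

lemma comap_graphSet_subset : (comap D f hf).graphSet ⊆ D.graphSet := by
  rintro p (⟨w, rfl⟩ | h)
  · exact pos_mem D (f w)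
  · simp only [mem_iUnion] at h
    obtain ⟨u, v, h, hp⟩ := h
    exact arcSet_subset D (f.map_adj h) hp

lemma comap_walkSet {a b : W} (p : H.Walk a b) :
    (comap D f hf).walkSet p = D.walkSet (p.map f) := by
  induction p with
  | nil => simp
  | cons h p ih => rw [Walk.map_cons, walkSet_cons, walkSet_cons, ih]; rfl
end

lemma frontier_mono [Finite V] {W : Type} [Finite W] {H : SimpleGraph W} (D' : Drawing H)
    (h : D'.graphSet ⊆ D.graphSet) {p : ℝ × ℝ} (hp : p ∈ frontier D.outerFace)
    (hp' : p ∈ D'.graphSet) : p ∈ frontier D'.outerFace := by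
  rw [outerFace_eq, (isOpen_ext (graphSet_compact _).isClosed).frontier_eq] at *
  exact ⟨closure_mono (ext_anti h) hp.1, fun hh => hh.1 hp'⟩

end
end PlaneTop

namespace PlaneTop
open SimpleGraph

section
variable {V : Type} {G : SimpleGraph V} (D : Drawing G)

variable {D} in
/-- A nonempty plane graph has a vertex on its outer face. -/
lemma exists_onOuter [Finite V] [Nonempty V] (hD : D.IsPlane) : ∃ w, D.OnOuter w := by
  classical
  cases nonempty_fintype V
  by_contra hcon
  push Not at hcon
  obtain ⟨w⟩ := ‹Nonempty V›
  set X := frontier D.outerFace with hX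
  have hXc : IsClosed X := isClosed_frontier
  have hXg : X ⊆ D.graphSet := frontier_ext_subset (graphSet_compact D).isClosed
  let A : V × V → Set (ℝ × ℝ) := fun e => {p | ∃ h : G.Adj e.1 e.2, p ∈ D.arcSet h}
  have hAc : ∀ e, IsClosed (A e) := by
    intro e
    by_cases h : G.Adj e.1 e.2
    · have : A e = D.arcSet h := by ext p; exact ⟨fun ⟨_, h'⟩ => h', fun h' => ⟨h, h'⟩⟩
      rw [this]; exact (arcSet_isArc D h).compact.isClosed
    · have : A e = ∅ := by ext p; exact ⟨fun ⟨h', _⟩ => (h h').elim, fun h' => h'.elim⟩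
      rw [this]; exact isClosed_empty
  have hlog : ∀ e, HasLog (fun z => toC z - toC (D.pos w)) (X ∩ A e) := by
    intro e
    by_cases h : G.Adj e.1 e.2
    · refine (hasLog_image (S := Ioo 0 1) (D.arc h).continuous (D.arc_inj h) ordConnected_Ioo
        (toC_sub_continuous _).continuousOn ?_).mono ?_
      · intro s hs
        refine toC_sub_ne fun e => ?_
        rcases D.arc_vertex h s w e with rfl | rfl
        · exact lt_irrefl _ hs.1
        · exact lt_irrefl _ hs.2
      · rintro p ⟨hp, h', hp'⟩
        rw [← IsArc.interior_eq (D.arc_inj h)]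
        refine ⟨hp', ?_⟩
        rintro (rfl | rfl)
        · exact hcon _ hp
        · exact hcon _ hp
    · have : X ∩ A e = ∅ := by ext p; exact ⟨fun ⟨_, h', _⟩ => (h h').elim, fun h' => h'.elim⟩
      rw [this]; exact ⟨0, continuousOn_empty _, by simp⟩
  have key : ∀ T : Finset (V × V),
      HasLog (fun z => toC z - toC (D.pos w)) (X ∩ ⋃ e ∈ T, A e) := by
    intro T
    induction T using Finset.induction_on with
    | empty => simp only [Finset.notMem_empty, iUnion_of_empty, iUnion_empty, inter_empty]
               exact ⟨0, continuousOn_empty _, by simp⟩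
    | insert e T he ih =>
      have hU : (⋃ e' ∈ insert e T, A e') = A e ∪ ⋃ e' ∈ T, A e' := by
        rw [Finset.set_biUnion_insert]
      rw [hU, inter_union_distrib_left]
      have hTc : IsClosed (⋃ e' ∈ T, A e') := by
        apply Set.Finite.isClosed_biUnion T.finite_toSet
        intro i _; exact hAc i
      by_cases hsw : e.swap ∈ T
      · have hsub : X ∩ A e ⊆ X ∩ ⋃ e' ∈ T, A e' := by
          rintro p ⟨hp, h', hp'⟩
          refine ⟨hp, ?_⟩
          simp only [mem_iUnion]
          exact ⟨e.swap, hsw, h'.symm, by rw [arcSet_symm]; exact hp'⟩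
        rwa [union_eq_right.2 hsub]
      · refine HasLog.glue (hXc.inter (hAc e)) (hXc.inter hTc) ?_ (hlog e) ih
        have : (X ∩ A e) ∩ (X ∩ ⋃ e' ∈ T, A e') = ∅ := by
          ext p
          simp only [mem_iUnion, mem_inter_iff, mem_empty_iff_false, iff_false]
          rintro ⟨⟨hp, h, hp1⟩, -, e', he', h', hp2⟩
          obtain ⟨x, rfl, -, -⟩ := arc_inter hD h h' (by
            intro e1
            rcases Sym2.eq_iff.1 e1 with ⟨e2, e3⟩ | ⟨e2, e3⟩
            · exact he (by rwa [show e = e' from Prod.ext e2 e3])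
            · exact hsw (by rwa [show e.swap = e' from Prod.ext e3 e2])) hp1 hp2
          exact hcon x hp
        rw [this]; exact isPreconnected_empty
  have hall : X ∩ (⋃ e ∈ (Finset.univ : Finset (V × V)), A e) = X := by
    apply inter_eq_left.2
    intro p hp
    rcases hXg hp with ⟨x, rfl⟩ | h
    · exact absurd hp (hcon x)
    · simp only [mem_iUnion] at h ⊢
      obtain ⟨u, v, h, hp⟩ := h
      exact ⟨(u, v), Finset.mem_univ _, h, hp⟩
  have hfin := key Finset.univ
  rw [hall] at hfin
  have := mem_ext_of_hasLog_frontier (graphSet_compact D) (p := D.pos w) (hcon w) hfin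
  exact this.1 (pos_mem D w)

end

section
variable {V : Type} {G : SimpleGraph V} (D : Drawing G)

/-- The drawing restricted to a set of vertices. -/
abbrev sub (S : Set V) : Drawing (G.induce S) :=
  comap D (Embedding.induce (G := G) S).toHom Subtype.val_injective

variable {D} in
lemma sub_graphSet_edge (hD : D.IsPlane) {S : Set V} {x y : V} (h : G.Adj x y) (hx : x ∉ S)
    {p : ℝ × ℝ} (hp : p ∈ D.arcSet h) (hp' : p ∈ (sub D S).graphSet) : y ∈ S ∧ p = D.pos y := by
  rcases hp' with ⟨w, rfl⟩ | h'
  · rcases mem_arcSet_pos D h hp with e | e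
    · exact absurd (e ▸ w.2) hx
    · exact ⟨e ▸ w.2, congrArg D.pos e⟩
  · simp only [mem_iUnion] at h'
    obtain ⟨u, v, h', hp'⟩ := h'
    have h'' : G.Adj u v := h'
    obtain ⟨w, rfl, hw, hw'⟩ := arc_inter hD h h'' (by
      intro e
      rcases Sym2.eq_iff.1 e with ⟨e2, e3⟩ | ⟨e2, e3⟩
      · exact hx (e2 ▸ u.2)
      · exact hx (e2 ▸ v.2)) hp hp'
    have hwS : w ∈ S := by rcases hw' with rfl | rfl <;> exact Subtype.prop _
    rcases hw with rfl | rfl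
    · exact absurd hwS hx
    · exact ⟨hwS, rfl⟩

variable {D} in
lemma outer_reach [Finite V] (hD : D.IsPlane) {S : Set V} {v : V} (hv : v ∈ S)
    (hS : ∀ x ∉ S, ∀ y ∈ S, G.Adj x y → y = v) {x : V} (W : G.Walk x v) (hx : x ∉ S)
    (ho : D.pos x ∈ (sub D S).outerFace) : D.pos v ∈ frontier (sub D S).outerFace := by
  have hcl := (graphSet_compact (sub D S)).isClosed
  induction W with
  | nil => exact absurd hv hx
  | @cons x y v h p ih =>
    have hI : IsPreconnected (D.arc h '' Ico 0 1) :=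
      isPreconnected_Ico.image _ (D.arc h).continuous.continuousOn
    have hsub : D.arc h '' Ico 0 1 ⊆ (sub D S).outerFace := by
      apply subset_ext hI
      · rintro s ⟨t, ht, rfl⟩ hs
        obtain ⟨-, e⟩ := sub_graphSet_edge hD h hx ⟨t, rfl⟩ hs
        have := D.arc_inj h (e.trans (D.arc h).target.symm)
        exact ht.2.ne this
      · exact ⟨D.pos x, ⟨0, ⟨le_rfl, zero_lt_one⟩, (D.arc h).source⟩, ho⟩
    have hcy : D.pos y ∈ closure (sub D S).outerFace := by
      apply closure_mono hsub
      have h1 : (1 : unitInterval) ∈ closure (Ico (0 : unitInterval) 1) := by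
        rw [closure_Ico zero_ne_one]; exact ⟨zero_le_one, le_rfl⟩
      have := image_closure_subset_closure_image (D.arc h).continuous ⟨1, h1, rfl⟩
      rwa [(D.arc h).target] at this
    by_cases hy : y ∈ S
    · obtain rfl := hS x hx y hy h
      rw [outerFace_eq] at hcy ⊢
      rw [(isOpen_ext hcl).frontier_eq]
      exact ⟨hcy, fun hh => hh.1 (pos_mem (sub D S) ⟨y, hv⟩)⟩
    · refine ih hv hS hy ?_
      by_contra hno
      have hf : D.pos y ∈ frontier (sub D S).outerFace := by
        rw [outerFace_eq] at *
        rw [(isOpen_ext hcl).frontier_eq]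
        exact ⟨hcy, hno⟩
      have hg := frontier_ext_subset hcl hf
      exact hy (sub_graphSet_edge hD h hx (arcSet_isArc D h).right_mem hg).1

variable {D} in
lemma outer_of_frontier [Finite V] (hD : D.IsPlane) {S : Set V} {x : V} (hx : x ∉ S)
    (h : D.OnOuter x) : D.pos x ∈ (sub D S).outerFace := by
  have hcl := (graphSet_compact (sub D S)).isClosed
  have h1 : D.pos x ∈ closure (sub D S).outerFace :=
    closure_mono (ext_anti (comap_graphSet_subset D _ _)) h.1
  by_contra hno
  have hf : D.pos x ∈ frontier (sub D S).outerFace := by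
    rw [outerFace_eq] at *
    rw [(isOpen_ext hcl).frontier_eq]
    exact ⟨h1, hno⟩
  rcases frontier_ext_subset hcl hf with ⟨w, e⟩ | h'
  · have : (w : V) = x := D.pos_inj e
    exact hx (this ▸ w.2)
  · simp only [mem_iUnion] at h'
    obtain ⟨u, v, h', hp'⟩ := h'
    have h'' : G.Adj u v := h'
    rcases mem_arcSet_pos D h'' hp' with rfl | rfl <;> exact hx (Subtype.prop _)

end
end PlaneTop

namespace PlaneTop
open SimpleGraph

lemma walkSet_map_id {V : Type} {G : SimpleGraph V} (D : Drawing G) (ψ : G →g G)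
    (hψ : ∀ x, ψ x = x) {a b : V} (p : G.Walk a b) : D.walkSet (p.map ψ) = D.walkSet p := by
  induction p with
  | nil => simp [hψ]
  | @cons u v w h p ih =>
    rw [Walk.map_cons, walkSet_cons, walkSet_cons, ih]
    congr 1
    exact arcSet_congr D _ _ (by rw [hψ, hψ])

lemma colorable_of_small {C : Config} (hmin : C.Minimal) {W : Type} [Fintype W]
    {H : SimpleGraph W} {D : Drawing H} (plane : D.IsPlane) {a b : W} {P : H.Walk a b}
    (P_path : P.IsPath) (P_len : P.length ≤ 2) (P_boundary : D.walkSet P ⊆ frontier D.outerFace)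
    {L : W → Finset ℕ} (size5 : ∀ v, ¬ D.OnOuter v → 5 ≤ (L v).card)
    (size3 : ∀ v, D.OnOuter v → v ∉ P.support → 3 ≤ (L v).card)
    (size1 : ∀ v ∈ P.support, (L v).card = 1)
    (no_adjacent_3 : ∀ u v, H.Adj u v → (L u).card = 3 → (L v).card ≠ 3)
    (proper_on_P : ∀ u ∈ P.support, ∀ v ∈ P.support, H.Adj u v → L u ≠ L v)
    (common_neighbor : ∀ p₀ p₁ p₂ : W, P.support = [p₀, p₁, p₂] →
      ∀ x, H.Adj x p₀ → H.Adj x p₁ → H.Adj x p₂ → L x ≠ L p₀ ∪ L p₁ ∪ L p₂)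
    (hsize : Fintype.card W + H.edgeSet.ncard < C.size) : ListColorable H L := by
  by_contra hcol
  let e : W ≃ Fin (Fintype.card W) := Fintype.equivFin W
  let φ : H.comap e.symm ≃g H := Iso.comap e.symm H
  let f : H.comap e.symm →g H := φ.toHom
  let g : H →g H.comap e.symm := φ.symm.toHom
  have hfg : ∀ x, f (g x) = x := fun x => φ.apply_symm_apply x
  have hgf : ∀ x, g (f x) = x := fun x => φ.symm_apply_apply x
  have hfi : Function.Injective f := φ.injective
  let D' := comap D f hfi
  have hgs : D'.graphSet = D.graphSet := by
    apply Subset.antisymm (comap_graphSet_subset D f hfi)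
    rintro p (⟨w, rfl⟩ | h)
    · left; exact ⟨g w, congrArg D.pos (hfg w)⟩
    · simp only [mem_iUnion] at h
      obtain ⟨u, v, h, hp⟩ := h
      right
      simp only [mem_iUnion]
      refine ⟨g u, g v, g.map_adj h, ?_⟩
      have : D.arcSet h = D.arcSet (f.map_adj (g.map_adj h)) :=
        arcSet_congr D _ _ (by rw [hfg, hfg])
      rw [this] at hp
      exact hp
  have hout : D'.outerFace = D.outerFace := by
    rw [outerFace_eq, outerFace_eq, hgs]
  have hon : ∀ v, D'.OnOuter v ↔ D.OnOuter (f v) := by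
    intro v
    unfold Drawing.OnOuter
    rw [hout]; rfl
  let P' := P.map g
  have hPs : P.support = P'.support.map f := by
    rw [Walk.support_map, List.map_map]
    conv_lhs => rw [← List.map_id P.support]
    apply List.map_congr_left
    intro x _; exact (hfg x).symm
  have hmem : ∀ v, v ∈ P'.support ↔ f v ∈ P.support := by
    intro v
    rw [hPs, List.mem_map_of_injective hfi]
  have hws : D'.walkSet P' = D.walkSet P := by
    have : D'.walkSet P' = D.walkSet ((P.map g).map f) := comap_walkSet D f hfi _
    rw [this, Walk.map_map]
    exact walkSet_map_id D _ hfg P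
  let C' : Config :=
    { n := Fintype.card W
      G := H.comap e.symm
      D := D'
      plane := comap_plane D f hfi plane
      a := g a
      b := g b
      P := P'
      P_path := Walk.IsPath.map φ.symm.injective P_path
      P_len := by rw [Walk.length_map]; exact P_len
      P_boundary := by rw [hws, hout]; exact P_boundary
      L := fun v => L (f v)
      size5 := fun v hv => size5 _ (fun h => hv ((hon v).2 h))
      size3 := fun v hv hv' => size3 _ ((hon v).1 hv) (fun h => hv' ((hmem v).2 h))
      size1 := fun v hv => size1 _ ((hmem v).1 hv)
      no_adjacent_3 := fun u v h => no_adjacent_3 _ _ (f.map_adj h)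
      proper_on_P := fun u hu v hv h => proper_on_P _ ((hmem u).1 hu) _ ((hmem v).1 hv) (f.map_adj h)
      common_neighbor := fun p₀ p₁ p₂ hp x h0 h1 h2 =>
        common_neighbor (f p₀) (f p₁) (f p₂) (by rw [hPs, hp]; rfl) (f x)
          (f.map_adj h0) (f.map_adj h1) (f.map_adj h2)
      not_colorable := by
        rintro ⟨c, hc1, hc2⟩
        refine hcol ⟨fun w => c (g w), fun w => ?_, fun u v h => hc2 (g.map_adj h)⟩
        have h3 : c (g w) ∈ L (f (g w)) := hc1 (g w)
        rwa [hfg] at h3 }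
  have h1 := hmin.1 C'
  have h2 : C'.size = Fintype.card W + H.edgeSet.ncard := by
    change Fintype.card W + (H.comap e.symm).edgeSet.ncard = _
    congr 1
    rw [← Nat.card_coe_set_eq, ← Nat.card_coe_set_eq]
    exact Nat.card_congr φ.mapEdgeSet
  omega

/-- Partial list colourings on a set of vertices. -/
def ColorOn {V : Type} (G : SimpleGraph V) (S : Set V) (L : V → Finset ℕ) (c : V → ℕ) : Prop :=
  (∀ v ∈ S, c v ∈ L v) ∧ ∀ u ∈ S, ∀ v ∈ S, G.Adj u v → c u ≠ c v

lemma L_ge_three (C : Config) {v : Fin C.n} (hv : v ∉ C.P.support) : 3 ≤ (C.L v).card := by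
  by_cases h : C.D.OnOuter v
  · exact C.size3 v h hv
  · have := C.size5 v h; omega

lemma color_sub {C : Config} (hmin : C.Minimal) {S : Set (Fin C.n)} (hS : S ≠ univ)
    {a b : Fin C.n} (Q : C.G.Walk a b) (hQp : Q.IsPath) (hQl : Q.length ≤ 2)
    (hQS : ∀ v ∈ Q.support, v ∈ S)
    (hQb : C.D.walkSet Q ⊆ frontier (sub C.D S).outerFace)
    (L : Fin C.n → Finset ℕ)
    (hL : ∀ v ∈ S, v ∉ Q.support → v ∉ C.P.support ∧ L v = C.L v)
    (hL1 : ∀ v ∈ Q.support, (L v).card = 1)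
    (hprop : ∀ u ∈ Q.support, ∀ v ∈ Q.support, C.G.Adj u v → L u ≠ L v)
    (hcom : ∀ p₀ p₁ p₂, Q.support = [p₀, p₁, p₂] →
      ∀ x ∈ S, C.G.Adj x p₀ → C.G.Adj x p₁ → C.G.Adj x p₂ → L x ≠ L p₀ ∪ L p₁ ∪ L p₂) :
    ∃ c, ColorOn C.G S L c := by
  classical
  obtain ⟨P, hPm⟩ : ∃ P : (C.G.induce S).Walk ⟨a, hQS _ Q.start_mem_support⟩
      ⟨b, hQS _ Q.end_mem_support⟩, P.map (Embedding.induce (G := C.G) S).toHom = Q :=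
    ⟨Q.induce S hQS, Walk.map_induce Q hQS⟩
  have hPs : Q.support = P.support.map Subtype.val := by
    have := congrArg Walk.support hPm
    rw [Walk.support_map] at this
    exact this.symm
  have hmem : ∀ v : S, v ∈ P.support ↔ (v : Fin C.n) ∈ Q.support := by
    intro v
    rw [hPs, List.mem_map_of_injective Subtype.val_injective]
  have hws : (sub C.D S).walkSet P = C.D.walkSet Q := by
    exact (comap_walkSet C.D _ _ P).trans (congrArg C.D.walkSet hPm)
  have hon : ∀ v : S, C.D.OnOuter v → (sub C.D S).OnOuter v := by
    intro v hv
    exact frontier_mono C.D (sub C.D S) (comap_graphSet_subset _ _ _) hv (pos_mem (sub C.D S) v)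
  have hcol : ListColorable (C.G.induce S) (fun v : S => L v) := by
    refine colorable_of_small hmin (D := sub C.D S) (comap_plane _ _ _ C.plane) (P := P) ?_ ?_
      (by rw [hws]; exact hQb) ?_ ?_ ?_ ?_ ?_ ?_ ?_
    · rw [← hPm] at hQp
      exact Walk.IsPath.of_map hQp
    · have := congrArg Walk.length hPm
      rw [Walk.length_map] at this
      rw [this]; exact hQl
    · intro v hv
      by_cases hvQ : (v : Fin C.n) ∈ Q.support
      · exact absurd (hQb ((pos_mem_walkSet C.D).2 hvQ)) hv
      · obtain ⟨-, e⟩ := hL v v.2 hvQ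
        rw [e]
        exact C.size5 v (fun h => hv (hon v h))
    · intro v _ hvP
      rw [hmem] at hvP
      obtain ⟨h1, e⟩ := hL v v.2 hvP
      rw [e]; exact L_ge_three C h1
    · intro v hv; exact hL1 v ((hmem v).1 hv)
    · intro u v h hu hv
      have huQ : (u : Fin C.n) ∉ Q.support := fun hh => by have := hL1 u hh; omega
      have hvQ : (v : Fin C.n) ∉ Q.support := fun hh => by have := hL1 v hh; omega
      rw [(hL u u.2 huQ).2] at hu
      rw [(hL v v.2 hvQ).2] at hv
      exact C.no_adjacent_3 u v h hu hv
    · intro u hu v hv h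
      exact hprop u ((hmem u).1 hu) v ((hmem v).1 hv) h
    · intro p₀ p₁ p₂ hp x h0 h1 h2
      exact hcom p₀ p₁ p₂ (by rw [hPs, hp]; rfl) x x.2 h0 h1 h2
    · have h1 : Fintype.card S < C.n := by
        obtain ⟨x, hx⟩ := (ne_univ_iff_exists_notMem S).1 hS
        have := Fintype.card_subtype_lt (p := fun y => y ∈ S) hx
        simpa using this
      have h2 : (C.G.induce S).edgeSet.ncard ≤ C.G.edgeSet.ncard := by
        rw [← Nat.card_coe_set_eq, ← Nat.card_coe_set_eq]
        exact Nat.card_le_card_of_injective _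
          (Embedding.mapEdgeSet (Embedding.induce (G := C.G) S)).injective
      unfold Config.size
      omega
  obtain ⟨c, hc1, hc2⟩ := hcol
  refine ⟨fun v => if h : v ∈ S then c ⟨v, h⟩ else 0, ?_, ?_⟩
  · intro v hv
    simp only [hv, dif_pos]
    exact hc1 ⟨v, hv⟩
  · intro u hu v hv h
    simp only [hu, hv, dif_pos]
    exact hc2 (u := ⟨u, hu⟩) (v := ⟨v, hv⟩) h

lemma glue_color (C : Config) {S T : Set (Fin C.n)} (hST : S ∪ T = univ)
    (hno : ∀ x ∈ S \ T, ∀ y ∈ T \ S, ¬ C.G.Adj x y) {L₁ L₂ : Fin C.n → Finset ℕ} {c₁ c₂ : Fin C.n → ℕ}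
    (h1 : ColorOn C.G S L₁ c₁) (h2 : ColorOn C.G T L₂ c₂) (hL1 : ∀ v, L₁ v ⊆ C.L v)
    (hL2 : ∀ v, L₂ v ⊆ C.L v) (hag : ∀ v ∈ S ∩ T, c₁ v = c₂ v) : False := by
  classical
  apply C.not_colorable
  have hT : ∀ v, v ∉ S → v ∈ T := fun v hv => by
    have : v ∈ S ∪ T := hST ▸ mem_univ v
    exact this.resolve_left hv
  have key : ∀ u v, u ∈ S → v ∉ S → C.G.Adj u v → c₁ u ≠ c₂ v := by
    intro u v hu hv h
    by_cases huT : u ∈ T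
    · rw [hag u ⟨hu, huT⟩]; exact h2.2 u huT v (hT v hv) h
    · exact absurd h (hno u ⟨hu, huT⟩ v ⟨hT v hv, hv⟩)
  refine ⟨fun v => if v ∈ S then c₁ v else c₂ v, fun v => ?_, fun u v h => ?_⟩
  · by_cases hv : v ∈ S
    · simp only [hv, if_true]; exact hL1 v (h1.1 v hv)
    · simp only [hv, if_false]; exact hL2 v (h2.1 v (hT v hv))
  · by_cases hu : u ∈ S <;> by_cases hv : v ∈ S <;> simp only [hu, hv, if_true, if_false]
    · exact h1.2 u hu v hv h
    · exact key u v hu hv h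
    · exact (key v u hv hu h.symm).symm
    · exact h2.2 u (hT u hu) v (hT v hv) h

lemma exists_cut {W : Type} [Nonempty W] {H : SimpleGraph W} (h : ¬ H.Connected) :
    ∃ A : Set W, A.Nonempty ∧ Aᶜ.Nonempty ∧ ∀ x ∈ A, ∀ y ∉ A, ¬ H.Adj x y := by
  rw [connected_iff] at h
  have : ¬ H.Preconnected := fun hp => h ⟨hp, inferInstance⟩
  unfold SimpleGraph.Preconnected at this
  push Not at this
  obtain ⟨u, v, huv⟩ := this
  refine ⟨{x | H.Reachable u x}, ⟨u, Reachable.refl u⟩, ⟨v, huv⟩, ?_⟩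
  intro x hx y hy hxy
  exact hy (Reachable.trans hx hxy.reachable)

end PlaneTop

namespace PlaneTop
open SimpleGraph

lemma walkSet_sub_graphSet {V : Type} {G : SimpleGraph V} (D : Drawing G) {S : Set V} {a b : V}
    (Q : G.Walk a b) (hQ : ∀ v ∈ Q.support, v ∈ S) : D.walkSet Q ⊆ (sub D S).graphSet := by
  have h := congrArg D.walkSet (Walk.map_induce (s := S) Q hQ)
  have h2 := comap_walkSet D (Embedding.induce (G := G) S).toHom Subtype.val_injective
    (Q.induce S hQ)
  intro p hp
  apply walkSet_subset (sub D S) (Q.induce S hQ)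
  exact h2 ▸ h ▸ hp

lemma color_Q {C : Config} (hmin : C.Minimal) {S : Set (Fin C.n)} (hS : S ≠ univ)
    {a b : Fin C.n} (Q : C.G.Walk a b) (hQp : Q.IsPath) (hQl : Q.length ≤ 2)
    (hQS : ∀ v ∈ Q.support, v ∈ S) (hw : C.D.walkSet Q ⊆ C.D.walkSet C.P)
    (hPQ : ∀ v ∈ S, v ∈ C.P.support → v ∈ Q.support)
    (hor : Q.length ≤ 1 ∨ Q.support = C.P.support) : ∃ c, ColorOn C.G S C.L c := by
  have hsup : ∀ v ∈ Q.support, v ∈ C.P.support := fun v hv =>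
    (pos_mem_walkSet C.D).1 (hw ((pos_mem_walkSet C.D).2 hv))
  refine color_sub hmin hS Q hQp hQl hQS ?_ C.L ?_ ?_ ?_ ?_
  · intro p hp
    exact frontier_mono C.D _ (comap_graphSet_subset _ _ _) (C.P_boundary (hw hp))
      (walkSet_sub_graphSet C.D Q hQS hp)
  · intro v hv hvQ
    exact ⟨fun h => hvQ (hPQ v hv h), rfl⟩
  · intro v hv; exact C.size1 v (hsup v hv)
  · intro u hu v hv; exact C.proper_on_P u (hsup u hu) v (hsup v hv)
  · intro p₀ p₁ p₂ hp x _
    rcases hor with h | h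
    · have := Q.length_support
      rw [hp] at this
      simp at this
      omega
    · exact C.common_neighbor p₀ p₁ p₂ (h ▸ hp) x

lemma color_nil {C : Config} (hmin : C.Minimal) {S : Set (Fin C.n)} (hS : S ≠ univ)
    {w : Fin C.n} (hw : w ∈ S) (hout : C.D.pos w ∈ frontier (sub C.D S).outerFace)
    (hP : ∀ v ∈ S, v ∈ C.P.support → v = w) (k : ℕ) (hk : k ∈ C.L w) :
    ∃ c, ColorOn C.G S C.L c ∧ c w = k := by
  classical
  obtain ⟨c, hc1, hc2⟩ := color_sub hmin hS (Walk.nil : C.G.Walk w w) Walk.IsPath.nil (by simp)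
    (by simpa using hw) (by simpa using hout) (Function.update C.L w {k})
    (by
      intro v hv hvw
      simp only [Walk.support_nil, List.mem_singleton] at hvw
      exact ⟨fun h => hvw (hP v hv h), Function.update_of_ne hvw _ _⟩)
    (by simp) (by simp) (by simp)
  refine ⟨c, ⟨fun v hv => ?_, hc2⟩, by simpa using hc1 w hw⟩
  have := hc1 v hv
  by_cases h : v = w
  · subst h
    simp only [Function.update_self, Finset.mem_singleton] at this
    rwa [this]
  · rwa [Function.update_of_ne h] at this

lemma cut_walk {V : Type} {G : SimpleGraph V} {A : Set V} (h : ∀ x ∈ A, ∀ y ∉ A, ¬ G.Adj x y)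
    {a b : V} (W : G.Walk a b) (ha : a ∈ A) : ∀ v ∈ W.support, v ∈ A := by
  induction W with
  | nil => simpa using ha
  | @cons x y z hxy p ih =>
    intro v hv
    have hy : y ∈ A := by
      by_contra hy; exact h x ha y hy hxy
    rw [Walk.support_cons, List.mem_cons] at hv
    rcases hv with rfl | hv
    · exact ha
    · exact ih hy v hv

lemma color_P {C : Config} (hmin : C.Minimal) {S : Set (Fin C.n)} (hS : S ≠ univ)
    (hPS : ∀ v ∈ C.P.support, v ∈ S) : ∃ c, ColorOn C.G S C.L c :=
  color_Q hmin hS C.P C.P_path C.P_len hPS Subset.rfl (fun _ _ h => h) (Or.inr rfl)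

lemma no_cut {C : Config} (hmin : C.Minimal) {A : Set (Fin C.n)} (hAc : Aᶜ.Nonempty)
    (h : ∀ x ∈ A, ∀ y ∉ A, ¬ C.G.Adj x y) (ha : C.a ∈ A) : False := by
  have hP := cut_walk h C.P ha
  obtain ⟨c₁, hc₁⟩ := color_P hmin (S := A) (by
    rintro rfl; simp at hAc) hP
  have : Nonempty ↑Aᶜ := hAc.to_subtype
  obtain ⟨w, hw⟩ := exists_onOuter (comap_plane C.D (Embedding.induce (G := C.G) Aᶜ).toHom
    Subtype.val_injective C.plane)
  have hwP : (w : Fin C.n) ∉ C.P.support := fun hh => w.2 (hP _ hh)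
  have h3 := L_ge_three C hwP
  obtain ⟨k, hk⟩ := Finset.card_pos.1 (by omega : 0 < (C.L w).card)
  obtain ⟨c₂, hc₂, -⟩ := color_nil hmin (S := Aᶜ) (fun e => by
    have : C.a ∈ Aᶜ := e ▸ mem_univ _
    exact this ha) w.2 hw (fun v hv hvP => absurd (hP v hvP) hv) k hk
  refine glue_color C (union_compl_self A) ?_ hc₁ hc₂ (fun _ => Subset.rfl) (fun _ => Subset.rfl) ?_
  · rintro x ⟨hx, -⟩ y ⟨hy, -⟩; exact h x hx y hy
  · rintro v ⟨h1, h2⟩; exact absurd h1 h2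

lemma config_connected {C : Config} (hmin : C.Minimal) : C.G.Connected := by
  by_contra hcon
  have : Nonempty (Fin C.n) := ⟨C.a⟩
  obtain ⟨A, h1, h2, h3⟩ := exists_cut hcon
  by_cases ha : C.a ∈ A
  · exact no_cut hmin h2 h3 ha
  · exact no_cut hmin (A := Aᶜ) (by simpa using h1)
      (fun x hx y hy h => h3 y (not_not.1 hy) x hx h.symm) ha

lemma exists_off (C : Config) : ∃ x, x ∉ C.P.support := by
  by_contra hcon
  push Not at hcon
  apply C.not_colorable
  have h1 : ∀ v, ∃ k, C.L v = {k} := fun v => Finset.card_eq_one.1 (C.size1 v (hcon v))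
  choose c hc using h1
  refine ⟨c, fun v => by rw [hc v]; simp, fun u v h e => ?_⟩
  apply C.proper_on_P u (hcon u) v (hcon v) h
  rw [hc u, hc v, e]

lemma degree_off {C : Config} (hmin : C.Minimal) {v : Fin C.n} (hv : v ∉ C.P.support) :
    (C.L v).card ≤ (C.G.neighborSet v).ncard := by
  classical
  by_contra hlt
  push Not at hlt
  obtain ⟨c, hc1, hc2⟩ := color_P hmin (S := {v}ᶜ) (fun e => by
    have : v ∈ ({v}ᶜ : Set (Fin C.n)) := e ▸ mem_univ _
    exact this rfl) (by
    intro x hx hxv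
    exact hv (by rwa [← mem_singleton_iff.1 hxv]))
  have : ∃ k ∈ C.L v, k ∉ c '' C.G.neighborSet v := by
    by_contra hno
    push Not at hno
    have h1 : ((C.L v : Set ℕ)).ncard ≤ (c '' C.G.neighborSet v).ncard :=
      ncard_le_ncard (fun k hk => hno k hk) (toFinite _)
    have h2 := ncard_image_le (f := c) (toFinite (C.G.neighborSet v))
    rw [ncard_coe_finset] at h1
    omega
  obtain ⟨k, hk, hk'⟩ := this
  apply C.not_colorable
  have key : ∀ u, C.G.Adj v u → c u ≠ k := fun u h e => hk' ⟨u, h, e⟩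
  refine ⟨Function.update c v k, fun x => ?_, fun x y h => ?_⟩
  · by_cases hx : x = v
    · subst hx; simpa using hk
    · rw [Function.update_of_ne hx]; exact hc1 x hx
  · by_cases hx : x = v
    · subst hx
      rw [Function.update_self, Function.update_of_ne h.ne']
      exact (key y h).symm
    · by_cases hy : y = v
      · subst hy
        rw [Function.update_self, Function.update_of_ne hx]
        exact key x h.symm
      · rw [Function.update_of_ne hx, Function.update_of_ne hy]
        exact hc2 x hx y hy h

lemma four_le {C : Config} (hmin : C.Minimal) : 4 ≤ C.n := by
  obtain ⟨x, hx⟩ := exists_off C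
  have h1 := degree_off hmin hx
  have h2 := L_ge_three C hx
  have h3 : (C.G.neighborSet x).ncard < (univ : Set (Fin C.n)).ncard :=
    ncard_lt_ncard (ssubset_univ_iff.2 (fun e => by
      have : x ∈ C.G.neighborSet x := e ▸ mem_univ x
      exact C.G.loopless.irrefl x this)) (toFinite _)
  rw [ncard_univ, Nat.card_fin] at h3
  omega

lemma degree_all {C : Config} (hmin : C.Minimal) (v : Fin C.n) :
    (C.L v).card ≤ (C.G.neighborSet v).ncard := by
  by_cases hv : v ∈ C.P.support
  · rw [C.size1 v hv]
    obtain ⟨x, hx⟩ := exists_off C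
    obtain ⟨W⟩ := (config_connected hmin).preconnected v x
    cases W with
    | nil => exact absurd hv hx
    | cons h p => exact (ncard_pos (toFinite _)).2 ⟨_, h⟩
  · exact degree_off hmin hv

lemma path_split {V : Type} {G : SimpleGraph V} (D : Drawing G) {a b : V} (P : G.Walk a b)
    (hP : P.IsPath) (hl : P.length ≤ 2) {v : V} {A B : Set V}
    (hcov : ∀ x, x = v ∨ x ∈ A ∨ x ∈ B) (hno : ∀ x ∈ A, ∀ y ∈ B, ¬ G.Adj x y) :
    (∀ x ∈ P.support, x ∈ insert v A) ∨ (∀ x ∈ P.support, x ∈ insert v B) ∨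
    ∃ (p q : V) (Q₁ : G.Walk p v) (Q₂ : G.Walk q v), Q₁.IsPath ∧ Q₂.IsPath ∧ Q₁.length ≤ 1 ∧
      Q₂.length ≤ 1 ∧ D.walkSet P = D.walkSet Q₁ ∪ D.walkSet Q₂ ∧ p ∈ A ∧ q ∈ B := by
  have hno' : ∀ x ∈ B, ∀ y ∈ A, ¬ G.Adj x y := fun x hx y hy h => hno y hy x hx h.symm
  cases P with
  | nil =>
    simp only [Walk.support_nil, List.mem_singleton, forall_eq]
    rcases hcov a with h | h | h <;> simp [h]
  | @cons _ m _ h p =>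
    cases p with
    | nil =>
      simp only [Walk.support_cons, Walk.support_nil, List.mem_cons, List.not_mem_nil, or_false,
        forall_eq_or_imp, forall_eq, mem_insert_iff]
      have := hno a; have := hno' a
      have := hcov a; have := hcov b
      grind
    | @cons _ m' _ h' p =>
      cases p with
      | cons h'' p => simp only [Walk.length_cons] at hl; omega
      | nil =>
        have key : ∀ (A B : Set V), a ∈ A → b ∈ B → m = v →
          ∃ (p q : V) (Q₁ : G.Walk p v) (Q₂ : G.Walk q v), Q₁.IsPath ∧ Q₂.IsPath ∧ Q₁.length ≤ 1 ∧
            Q₂.length ≤ 1 ∧ D.walkSet (Walk.cons h (Walk.cons h' Walk.nil)) =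
              D.walkSet Q₁ ∪ D.walkSet Q₂ ∧ p ∈ A ∧ q ∈ B := by
          intro A B ha hb e
          subst e
          refine ⟨a, b, Walk.cons h Walk.nil, Walk.cons h'.symm Walk.nil, ?_, ?_, by simp, by simp,
            ?_, ha, hb⟩
          · simp [h.ne]
          · simp [h'.ne']
          · simp only [walkSet_cons, walkSet_nil, arcSet_symm D h']
            have h1 := (arcSet_isArc D h).right_mem
            have h2 := (arcSet_isArc D h').right_mem
            ext x
            simp only [mem_union, mem_singleton_iff]
            grind
        have key' : a ∈ B → b ∈ A → m = v →
          ∃ (p q : V) (Q₁ : G.Walk p v) (Q₂ : G.Walk q v), Q₁.IsPath ∧ Q₂.IsPath ∧ Q₁.length ≤ 1 ∧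
            Q₂.length ≤ 1 ∧ D.walkSet (Walk.cons h (Walk.cons h' Walk.nil)) =
              D.walkSet Q₁ ∪ D.walkSet Q₂ ∧ p ∈ A ∧ q ∈ B := by
          intro h1 h2 h3
          obtain ⟨p, q, Q₁, Q₂, g1, g2, g3, g4, g5, g6, g7⟩ := key B A h1 h2 h3
          exact ⟨q, p, Q₂, Q₁, g2, g1, g4, g3, by rw [g5, union_comm], g7, g6⟩
        have key := key A B
        by_cases h3 : ∃ (p q : V) (Q₁ : G.Walk p v) (Q₂ : G.Walk q v), Q₁.IsPath ∧ Q₂.IsPath ∧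
            Q₁.length ≤ 1 ∧ Q₂.length ≤ 1 ∧ D.walkSet (Walk.cons h (Walk.cons h' Walk.nil)) =
              D.walkSet Q₁ ∪ D.walkSet Q₂ ∧ p ∈ A ∧ q ∈ B
        · exact Or.inr (Or.inr h3)
        · simp only [h3, imp_false] at key key'
          simp only [h3, or_false]
          simp only [Walk.support_cons, Walk.support_nil, List.mem_cons, List.not_mem_nil, or_false,
            forall_eq_or_imp, forall_eq, mem_insert_iff]
          have := hno a; have := hno' a; have := hno m; have := hno' m
          have := hcov a; have := hcov b; have := hcov m
          have hab : a ≠ b := by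
            rintro rfl
            simp at hP
          have := h.ne; have := h'.ne
          grind

lemma no_sep_P {C : Config} (hmin : C.Minimal) {v : Fin C.n} {A B : Set (Fin C.n)}
    (hvA : v ∉ A) (hvB : v ∉ B) (hAB : ∀ x ∈ A, x ∉ B) (hA : A.Nonempty) (hB : B.Nonempty)
    (hcov : ∀ x, x = v ∨ x ∈ A ∨ x ∈ B) (hno : ∀ x ∈ A, ∀ y ∈ B, ¬ C.G.Adj x y)
    (hP : ∀ x ∈ C.P.support, x ∈ insert v A) : False := by
  have hSne : insert v A ≠ univ := by
    obtain ⟨y, hy⟩ := hB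
    intro e
    have : y ∈ insert v A := e ▸ mem_univ y
    rcases this with rfl | h
    · exact hvB hy
    · exact hAB y h hy
  have hTne : insert v B ≠ univ := by
    obtain ⟨y, hy⟩ := hA
    intro e
    have : y ∈ insert v B := e ▸ mem_univ y
    rcases this with rfl | h
    · exact hvA hy
    · exact hAB y hy h
  obtain ⟨c₁, hc₁⟩ := color_P hmin hSne hP
  have hout : C.D.pos v ∈ frontier (sub C.D (insert v B)).outerFace := by
    by_cases hvP : v ∈ C.P.support
    · exact frontier_mono C.D _ (comap_graphSet_subset _ _ _)
        (C.P_boundary ((pos_mem_walkSet C.D).2 hvP))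
        (pos_mem (sub C.D (insert v B)) ⟨v, mem_insert _ _⟩)
    · have haP := C.P.start_mem_support
      have haA : C.a ∈ A := (hP _ haP).resolve_left (fun e => hvP (e ▸ haP))
      have haT : C.a ∉ insert v B := by
        rintro (e | h)
        · exact hvA (e ▸ haA)
        · exact hAB _ haA h
      obtain ⟨W⟩ := (config_connected hmin).preconnected C.a v
      refine outer_reach C.plane (mem_insert _ _) ?_ W haT
        (outer_of_frontier C.plane haT (C.P_boundary ((pos_mem_walkSet C.D).2 haP)))
      intro x hx y hy hxy
      rcases hy with rfl | hy
      · rfl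
      · rcases hcov x with rfl | h | h
        · exact absurd (mem_insert _ _) hx
        · exact absurd hxy (hno x h y hy)
        · exact absurd (mem_insert_of_mem _ h) hx
  obtain ⟨c₂, hc₂, hcv⟩ := color_nil hmin hTne (mem_insert v B) hout (by
    rintro x (rfl | hx) hxP
    · rfl
    · rcases hP x hxP with rfl | h
      · rfl
      · exact absurd hx (hAB x h)) (c₁ v) (hc₁.1 v (mem_insert _ _))
  refine glue_color C ?_ ?_ hc₁ hc₂ (fun _ => Subset.rfl) (fun _ => Subset.rfl) ?_
  · ext x
    have := hcov x
    simp only [mem_union, mem_insert_iff, mem_univ, iff_true]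
    tauto
  · rintro x ⟨hx, hx'⟩ y ⟨hy, hy'⟩
    refine hno x ?_ y ?_
    · exact hx.resolve_left (fun e => hx' (e ▸ mem_insert _ _))
    · exact hy.resolve_left (fun e => hy' (e ▸ mem_insert _ _))
  · rintro x ⟨h1, h2⟩
    rcases h1 with rfl | h1
    · exact hcv.symm
    · rcases h2 with rfl | h2
      · exact hcv.symm
      · exact absurd h2 (hAB x h1)

lemma no_sep {C : Config} (hmin : C.Minimal) {v : Fin C.n} {A B : Set (Fin C.n)}
    (hvA : v ∉ A) (hvB : v ∉ B) (hAB : ∀ x ∈ A, x ∉ B) (hA : A.Nonempty) (hB : B.Nonempty)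
    (hcov : ∀ x, x = v ∨ x ∈ A ∨ x ∈ B) (hno : ∀ x ∈ A, ∀ y ∈ B, ¬ C.G.Adj x y) : False := by
  rcases path_split C.D C.P C.P_path C.P_len hcov hno with h | h |
    ⟨p, q, Q₁, Q₂, hp1, hp2, hl1, hl2, hw, hp, hq⟩
  · exact no_sep_P hmin hvA hvB hAB hA hB hcov hno h
  · exact no_sep_P hmin hvB hvA (fun x h1 h2 => hAB x h2 h1) hB hA
      (fun x => by have := hcov x; tauto) (fun x hx y hy h => hno y hy x hx h.symm) h
  have hs : ∀ {p : Fin C.n} (Q : C.G.Walk p v), Q.length ≤ 1 → ∀ x ∈ Q.support, x = p ∨ x = v := by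
    intro p Q hQ
    cases Q with
    | nil => simp
    | cons h r => cases r with
      | nil => simp
      | cons h' r => simp only [Walk.length_cons] at hQ; omega
  have hsupp : ∀ x ∈ C.P.support, x ∈ Q₁.support ∨ x ∈ Q₂.support := by
    intro x hx
    have := (pos_mem_walkSet C.D).2 hx
    rw [hw] at this
    exact this.imp (pos_mem_walkSet C.D).1 (pos_mem_walkSet C.D).1
  have hvP : v ∈ C.P.support := by
    rw [← pos_mem_walkSet C.D, hw]
    exact Or.inl ((pos_mem_walkSet C.D).2 Q₁.end_mem_support)
  obtain ⟨c₁, hc₁⟩ := color_Q hmin (S := insert v A) (fun e => by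
      have : q ∈ insert v A := e ▸ mem_univ q
      rcases this with rfl | h
      · exact hvB hq
      · exact hAB q h hq) Q₁ hp1 (by omega) (by
      intro x hx
      rcases hs Q₁ hl1 x hx with rfl | rfl
      · exact mem_insert_of_mem _ hp
      · exact mem_insert _ _) (by rw [hw]; exact subset_union_left) (by
      intro x hx hxP
      rcases hsupp x hxP with h | h
      · exact h
      · rcases hs Q₂ hl2 x h with rfl | rfl
        · rcases hx with rfl | h
          · exact absurd hq hvB
          · exact absurd hq (hAB _ h)
        · exact Q₁.end_mem_support) (Or.inl hl1)
  obtain ⟨c₂, hc₂⟩ := color_Q hmin (S := insert v B) (fun e => by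
      have : p ∈ insert v B := e ▸ mem_univ p
      rcases this with rfl | h
      · exact hvA hp
      · exact hAB p hp h) Q₂ hp2 (by omega) (by
      intro x hx
      rcases hs Q₂ hl2 x hx with rfl | rfl
      · exact mem_insert_of_mem _ hq
      · exact mem_insert _ _) (by rw [hw]; exact subset_union_right) (by
      intro x hx hxP
      rcases hsupp x hxP with h | h
      · rcases hs Q₁ hl1 x h with rfl | rfl
        · rcases hx with rfl | h
          · exact absurd hp hvA
          · exact absurd h (hAB _ hp)
        · exact Q₂.end_mem_support
      · exact h) (Or.inl hl2)
  have hcv : c₁ v = c₂ v := by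
    obtain ⟨k, hk⟩ := Finset.card_eq_one.1 (C.size1 v hvP)
    have h1 := hc₁.1 v (mem_insert _ _)
    have h2 := hc₂.1 v (mem_insert _ _)
    rw [hk, Finset.mem_singleton] at h1 h2
    rw [h1, h2]
  refine glue_color C ?_ ?_ hc₁ hc₂ (fun _ => Subset.rfl) (fun _ => Subset.rfl) ?_
  · ext x
    have := hcov x
    simp only [mem_union, mem_insert_iff, mem_univ, iff_true]
    tauto
  · rintro x ⟨hx, hx'⟩ y ⟨hy, hy'⟩
    refine hno x ?_ y ?_
    · exact hx.resolve_left (fun e => hx' (e ▸ mem_insert _ _))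
    · exact hy.resolve_left (fun e => hy' (e ▸ mem_insert _ _))
  · rintro x ⟨h1, h2⟩
    rcases h1 with rfl | h1
    · exact hcv
    · rcases h2 with rfl | h2
      · exact hcv
      · exact absurd h2 (hAB x h1)

lemma config_twoConnected {C : Config} (hmin : C.Minimal) : TwoConnected C.G := by
  have h4 := four_le hmin
  refine ⟨by rw [Fintype.card_fin]; omega, fun v => ?_⟩
  have hne : Nonempty ↑({v}ᶜ : Set (Fin C.n)) := by
    have : Nontrivial (Fin C.n) := Fin.nontrivial_iff_two_le.2 (by omega)
    obtain ⟨w, hw⟩ := exists_ne v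
    exact ⟨⟨w, hw⟩⟩
  by_contra hcon
  obtain ⟨A, ⟨x, hx⟩, ⟨y, hy⟩, h3⟩ := exists_cut hcon
  refine no_sep hmin (v := v) (A := Subtype.val '' A) (B := Subtype.val '' Aᶜ) ?_ ?_ ?_
    ⟨x, x, hx, rfl⟩ ⟨y, y, hy, rfl⟩ ?_ ?_
  · rintro ⟨z, -, e⟩; exact z.2 e
  · rintro ⟨z, -, e⟩; exact z.2 e
  · rintro _ ⟨z, hz, rfl⟩ ⟨z', hz', e⟩
    exact hz' ((Subtype.ext e : z' = z) ▸ hz)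
  · intro z
    by_cases hz : z = v
    · exact Or.inl hz
    · right
      by_cases hzA : (⟨z, hz⟩ : ↑({v}ᶜ : Set (Fin C.n))) ∈ A
      · exact Or.inl ⟨_, hzA, rfl⟩
      · exact Or.inr ⟨_, hzA, rfl⟩
  · rintro _ ⟨z, hz, rfl⟩ _ ⟨z', hz', rfl⟩ h
    exact h3 z hz z' hz' h

end PlaneTop

namespace PlaneTop
open SimpleGraph

section
variable {V : Type} {G : SimpleGraph V}

lemma append_isPath {a b c : V} {p : G.Walk a b} {q : G.Walk b c} (hp : p.IsPath) (hq : q.IsPath)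
    (h : ∀ x ∈ p.support, x ∈ q.support → x = b) : (p.append q).IsPath := by
  rw [Walk.isPath_def, Walk.support_append, List.nodup_append']
  have hq' := hq.support_nodup
  rw [← Walk.cons_tail_support, List.nodup_cons] at hq'
  refine ⟨hp.support_nodup, hq'.2, ?_⟩
  intro x hx hx'
  obtain rfl := h x hx (List.mem_of_mem_tail hx')
  exact hq'.1 hx'

variable (D : Drawing G)

variable {D} in
lemma cycle_split [DecidableEq V] {r : V} {F : G.Walk r r} (hF : F.IsCycle) {a b : V}
    (ha : a ∈ F.support) (hb : b ∈ F.support) (hab : a ≠ b) :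
    ∃ p q : G.Walk b a, p.IsPath ∧ q.IsPath ∧ D.walkSet F = D.walkSet p ∪ D.walkSet q ∧
      (∀ x ∈ p.support, x ∈ q.support → x = a ∨ x = b) ∧ (∀ e ∈ p.edges, e ∉ q.edges) ∧
      (∀ x ∈ p.support, x ∈ F.support) ∧ (∀ x ∈ q.support, x ∈ F.support) ∧
      (∀ x ∈ p.edges, x ∈ F.edges) ∧ (∀ x ∈ q.edges, x ∈ F.edges) := by
  have hws : D.walkSet (F.rotate a ha) = D.walkSet F := by
    unfold Walk.rotate
    rw [walkSet_append, union_comm, ← walkSet_append, Walk.take_spec]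
  have hed : ∀ e, e ∈ (F.rotate a ha).edges ↔ e ∈ F.edges := fun e =>
    (F.rotate_edges a ha).mem_iff
  have hcyc : (F.rotate a ha).IsCycle := hF.rotate ha
  have hsup : ∀ x, x ∈ (F.rotate a ha).support ↔ x ∈ F.support := by
    intro x
    rw [← pos_mem_walkSet D, ← pos_mem_walkSet D, hws]
  generalize F.rotate a ha = F' at *
  have hb' : b ∈ F'.support := (hsup b).2 hb
  have hspec := F'.take_spec hb'
  generalize F'.takeUntil b hb' = p₁ at hspec
  generalize F'.dropUntil b hb' = p₂ at hspec
  subst hspec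
  have hn1 : ¬ p₁.Nil := Walk.not_nil_of_ne hab
  have hn2 : ¬ p₂.Nil := Walk.not_nil_of_ne hab.symm
  refine ⟨p₂, p₁.reverse, hcyc.isPath_of_append_right hn1,
    (hcyc.isPath_of_append_left hn2).reverse, ?_, ?_, ?_, ?_, ?_, ?_, ?_⟩
  · rw [walkSet_reverse, ← hws, walkSet_append, union_comm]
  · intro x hx hx'
    rw [Walk.support_reverse, List.mem_reverse] at hx'
    have hnd := hcyc.support_nodup
    rw [Walk.tail_support_append, List.nodup_append'] at hnd
    rw [Walk.mem_support_iff] at hx hx'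
    rcases hx with rfl | hx
    · exact Or.inr rfl
    rcases hx' with rfl | hx'
    · exact Or.inl rfl
    exact absurd hx (hnd.2.2 hx')
  · intro e he he'
    rw [Walk.edges_reverse, List.mem_reverse] at he'
    have hnd := hcyc.isCircuit.isTrail.edges_nodup
    rw [Walk.edges_append, List.nodup_append'] at hnd
    exact hnd.2.2 he' he
  · intro x hx; rw [← hsup]; exact (Walk.mem_support_append_iff ..).2 (Or.inr hx)
  · intro x hx; rw [← hsup]; rw [Walk.support_reverse, List.mem_reverse] at hx
    exact (Walk.mem_support_append_iff ..).2 (Or.inl hx)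
  · intro x hx; rw [← hed, Walk.edges_append]; exact List.mem_append_right _ hx
  · intro x hx; rw [← hed, Walk.edges_append]; rw [Walk.edges_reverse, List.mem_reverse] at hx
    exact List.mem_append_left _ hx

lemma first_hit (X : Set V) {u b₀ : V} (W : G.Walk u b₀) (hb : b₀ ∈ X) :
    ∃ b ∈ X, ∃ Q : G.Walk u b, (∀ x ∈ Q.support, x ∈ W.support) ∧
      ∀ x ∈ Q.support, x ∈ X → x = b := by
  induction W with
  | nil => exact ⟨_, hb, Walk.nil, by simp, by simp⟩
  | @cons u y b₀ h p ih =>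
    by_cases hu : u ∈ X
    · exact ⟨u, hu, Walk.nil, by simp, by simp⟩
    · obtain ⟨b, hbX, Q, h1, h2⟩ := ih hb
      refine ⟨b, hbX, Walk.cons h Q, ?_, ?_⟩
      · intro x hx
        rw [Walk.support_cons, List.mem_cons] at hx ⊢
        exact hx.imp_right (h1 x)
      · intro x hx hxX
        rw [Walk.support_cons, List.mem_cons] at hx
        rcases hx with rfl | hx
        · exact absurd hxX hu
        · exact h2 x hx hxX

/-- A path in `G - a`. -/
lemma path_avoid [DecidableEq V] {a : V} (hc : (G.induce ({a}ᶜ : Set V)).Connected) {x y : V}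
    (hx : x ≠ a) (hy : y ≠ a) : ∃ W : G.Walk x y, a ∉ W.support := by
  have hx' : x ∈ ({a}ᶜ : Set V) := hx
  have hy' : y ∈ ({a}ᶜ : Set V) := hy
  obtain ⟨W⟩ := hc.preconnected ⟨x, hx'⟩ ⟨y, hy'⟩
  have hs : a ∉ (W.map (Embedding.induce (G := G) ({a}ᶜ : Set V)).toHom).support := by
    rw [Walk.support_map, List.mem_map]
    rintro ⟨z, -, hz⟩
    exact z.2 hz
  exact ⟨W.map (Embedding.induce (G := G) ({a}ᶜ : Set V)).toHom, hs⟩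

lemma exists_cycle [DecidableEq V] {v x y : V}
    (hc : (G.induce ({v}ᶜ : Set V)).Connected) (hx : G.Adj v x) (hy : G.Adj v y) (hxy : x ≠ y) :
    ∃ F : G.Walk v v, F.IsCycle := by
  obtain ⟨W, hW⟩ := path_avoid hc hx.ne' hy.ne'
  have hv : v ∉ W.bypass.support := fun h => hW (W.support_bypass_subset_support h)
  refine ⟨Walk.cons hx (W.bypass.concat hy.symm), ?_⟩
  rw [Walk.cons_isCycle_iff]
  refine ⟨W.bypass_isPath.concat hv _, ?_⟩
  rw [Walk.edges_concat, List.concat_eq_append, List.mem_append, List.mem_singleton]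
  rintro (h | h)
  · exact hv (Walk.fst_mem_support_of_mem_edges _ h)
  · rcases Sym2.eq_iff.1 h with ⟨e, -⟩ | ⟨-, e⟩
    · exact hy.ne e
    · exact hxy e

variable {D} in
/-- Adding an ear in the exterior of a cycle gives a cycle with smaller exterior. -/
lemma ear_improve [DecidableEq V] (hD : D.IsPlane) {r : V} {F : G.Walk r r} (hF : F.IsCycle)
    {a b u : V} (ha : a ∈ F.support) (hb : b ∈ F.support) (hab : a ≠ b) (h : G.Adj a u)
    (Q : G.Walk u b) (hQ : Q.IsPath) (haQ : a ∉ Q.support)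
    (hQF : ∀ x ∈ Q.support, x ∈ F.support → x = b) (hau : s(a, u) ∉ F.edges)
    (hm : (D.walkSet (Walk.cons h Q) ∩ ext (D.walkSet F)).Nonempty) :
    ∃ F' : G.Walk a a, F'.IsCycle ∧ ext (D.walkSet F') ⊆ ext (D.walkSet F) ∧
      (D.arcSet h ∩ ext (D.walkSet F)).Nonempty ∧ D.arcSet h ∩ ext (D.walkSet F') = ∅ := by
  obtain ⟨p, q, hp, hq, hw, hpq, hed, hps, hqs, hpe, hqe⟩ := cycle_split (D := D) hF ha hb hab
  have hE : (Walk.cons h Q).IsPath := (Walk.cons_isPath_iff h Q).2 ⟨hQ, haQ⟩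
  have hEa := path_isArc hD _ hE hab
  have hpa := (path_isArc hD _ hp hab.symm).symm
  have hqa := (path_isArc hD _ hq hab.symm).symm
  have hEF : ∀ e ∈ (Walk.cons h Q).edges, e ∉ F.edges := by
    intro e he heF
    rw [Walk.edges_cons, List.mem_cons] at he
    rcases he with rfl | he
    · exact hau heF
    · induction e using Sym2.ind with
      | _ x y =>
        have h1 := hQF x (Walk.fst_mem_support_of_mem_edges _ he) (Walk.fst_mem_support_of_mem_edges _ heF)
        have h2 := hQF y (Walk.snd_mem_support_of_mem_edges _ he) (Walk.snd_mem_support_of_mem_edges _ heF)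
        have h3 : G.Adj x y := Walk.adj_of_mem_edges _ he
        exact h3.ne (h1.trans h2.symm)
  have hmeet : D.walkSet (Walk.cons h Q) ∩ D.walkSet F ⊆ {D.pos a, D.pos b} := by
    rintro z ⟨hz1, hz2⟩
    obtain ⟨w, hw1, hw2, rfl⟩ := walkSet_inter hD hEF hz1 hz2
    rw [Walk.support_cons, List.mem_cons] at hw1
    rcases hw1 with rfl | hw1
    · exact Or.inl rfl
    · right; rw [hQF w hw1 hw2]; rfl
  have hcyc : ∀ p : G.Walk b a, p.IsPath → (∀ x ∈ p.support, x ∈ F.support) →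
      (∀ x ∈ p.edges, x ∈ F.edges) → (Walk.cons h (Q.append p)).IsCycle := by
    intro p hp hps hpe
    rw [Walk.cons_isCycle_iff]
    refine ⟨append_isPath hQ hp (fun x hx hx' => hQF x hx (hps x hx')), ?_⟩
    rw [Walk.edges_append, List.mem_append]
    rintro (he | he)
    · exact haQ (Walk.fst_mem_support_of_mem_edges _ he)
    · exact hau (hpe _ he)
  have hset : ∀ p : G.Walk b a, D.walkSet (Walk.cons h (Q.append p)) =
      D.walkSet p ∪ D.walkSet (Walk.cons h Q) := by
    intro p
    rw [walkSet_cons, walkSet_append, walkSet_cons, ← union_assoc, union_comm]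
  have hsub : D.walkSet (Walk.cons h Q) \ {D.pos a, D.pos b} ⊆ ext (D.walkSet F) := by
    apply subset_ext hEa.interior_preconnected
    · rintro z ⟨hz1, hz2⟩ hz3
      exact hz2 (hmeet ⟨hz1, hz3⟩)
    · obtain ⟨z, hz1, hz2⟩ := hm
      refine ⟨z, ⟨hz1, ?_⟩, hz2⟩
      rintro (rfl | rfl)
      · exact hz2.1 ((pos_mem_walkSet D).2 ha)
      · exact hz2.1 ((pos_mem_walkSet D).2 hb)
  have harc : (D.arcSet h ∩ ext (D.walkSet F)).Nonempty := by
    obtain ⟨z, hz1, hz2⟩ := (arcSet_isArc D h).interior_nonempty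
    refine ⟨z, hz1, hsub ⟨?_, ?_⟩⟩
    · rw [walkSet_cons]; exact Or.inl hz1
    · rintro (rfl | rfl)
      · exact hz2 (Or.inl rfl)
      · rcases mem_arcSet_pos D h hz1 with e | e
        · exact hab e.symm
        · exact hz2 (Or.inr (by rw [e]; rfl))
  have hdisj : ∀ p : G.Walk b a, D.arcSet h ∩ ext (D.walkSet (Walk.cons h (Q.append p))) = ∅ := by
    intro p
    ext z
    simp only [mem_inter_iff, mem_empty_iff_false, iff_false]
    rintro ⟨h1, h2⟩
    apply h2.1
    rw [walkSet_cons]; exact Or.inl h1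
  have hpq' : D.walkSet p ∩ D.walkSet q ⊆ {D.pos a, D.pos b} := by
    rintro z ⟨hz1, hz2⟩
    obtain ⟨w, hw1, hw2, rfl⟩ := walkSet_inter hD hed hz1 hz2
    rcases hpq w hw1 hw2 with rfl | rfl
    · exact Or.inl rfl
    · exact Or.inr rfl
  have := IsArc.theta hpa hqa hEa hpq'
    (fun z hz => hmeet ⟨hz.2, hw ▸ Or.inl hz.1⟩) (fun z hz => hmeet ⟨hz.2, hw ▸ Or.inr hz.1⟩)
    (by rw [← hw]; exact hsub)
  rw [← hw] at this
  rcases this with h1 | h1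
  · exact ⟨_, hcyc p hp hps hpe, by rw [hset]; exact h1, harc, hdisj p⟩
  · exact ⟨_, hcyc q hq hqs hqe, by rw [hset]; exact h1, harc, hdisj q⟩

end
end PlaneTop

namespace PlaneTop
open SimpleGraph

section
variable {V : Type} {G : SimpleGraph V} {D : Drawing G}

lemma arc_cycle_inter (hD : D.IsPlane) {r : V} {F : G.Walk r r} {x y : V} (h : G.Adj x y)
    (he : s(x, y) ∉ F.edges) {z : ℝ × ℝ} (hz : z ∈ D.arcSet h) (hz' : z ∈ D.walkSet F) :
    ∃ w ∈ F.support, (w = x ∨ w = y) ∧ z = D.pos w := by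
  have h1 : z ∈ D.walkSet (Walk.cons h Walk.nil) := by rw [walkSet_cons]; exact Or.inl hz
  obtain ⟨w, hw1, hw2, rfl⟩ := walkSet_inter hD (by
    intro e he' heF
    simp only [Walk.edges_cons, Walk.edges_nil, List.mem_singleton] at he'
    exact he (he' ▸ heF)) h1 hz'
  refine ⟨w, hw2, ?_, rfl⟩
  simpa using hw1

/-- Exterior propagates along arcs with no endpoint on the cycle. -/
lemma ext_step (hD : D.IsPlane) {r : V} {F : G.Walk r r} {x y : V} (h : G.Adj x y)
    (hx : x ∉ F.support) (hy : y ∉ F.support) (hm : (D.arcSet h ∩ ext (D.walkSet F)).Nonempty) :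
    D.arcSet h ⊆ ext (D.walkSet F) := by
  apply subset_ext (arcSet_isArc D h).preconnected _ hm
  intro z hz hz'
  obtain ⟨w, hw, rfl | rfl, -⟩ := arc_cycle_inter hD h
    (fun he => hx (Walk.fst_mem_support_of_mem_edges _ he)) hz hz'
  · exact hx hw
  · exact hy hw

lemma cycle_exists_ne {r : V} {F : G.Walk r r} (hF : F.IsCycle) (a : V) :
    ∃ b ∈ F.support, b ≠ a := by
  by_contra hcon
  push Not at hcon
  cases F with
  | nil => exact hF.1.2 rfl
  | cons h p =>
    have h1 := hcon r (by simp)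
    have h2 := hcon _ (List.mem_cons_of_mem _ p.start_mem_support)
    exact h.ne (h1.trans h2.symm)

lemma exists_attach (hD : D.IsPlane) {r : V} {F : G.Walk r r} {w : V}
    (W : G.Walk w r) (hw : D.pos w ∈ ext (D.walkSet F)) :
    ∃ a u, a ∈ F.support ∧ u ∉ F.support ∧ G.Adj a u ∧ D.pos u ∈ ext (D.walkSet F) := by
  have key : ∀ {w z : V} (W : G.Walk w z), z ∈ F.support → D.pos w ∈ ext (D.walkSet F) →
      ∃ a u, a ∈ F.support ∧ u ∉ F.support ∧ G.Adj a u ∧ D.pos u ∈ ext (D.walkSet F) := by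
    intro w z W
    induction W with
    | nil => intro hz hw; exact absurd ((pos_mem_walkSet D).2 hz) hw.1
    | @cons x y z h p ih =>
      intro hz hw
      have hx : x ∉ F.support := fun hx => hw.1 ((pos_mem_walkSet D).2 hx)
      by_cases hy : y ∈ F.support
      · exact ⟨y, x, hy, hx, h.symm, hw⟩
      · exact ih hz (ext_step hD h hx hy ⟨_, (arcSet_isArc D h).left_mem, hw⟩
          (arcSet_isArc D h).right_mem)
  exact key W F.start_mem_support hw

lemma vertex_improve [DecidableEq V] (hD : D.IsPlane) (hcon : G.Connected)
    (h2 : ∀ v : V, (G.induce ({v}ᶜ : Set V)).Connected)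
    {r : V} {F : G.Walk r r} (hF : F.IsCycle) {w : V} (hw : D.pos w ∈ ext (D.walkSet F)) :
    ∃ (a u : V) (h : G.Adj a u) (F' : G.Walk a a), F'.IsCycle ∧
      ext (D.walkSet F') ⊆ ext (D.walkSet F) ∧
      (D.arcSet h ∩ ext (D.walkSet F)).Nonempty ∧ D.arcSet h ∩ ext (D.walkSet F') = ∅ := by
  obtain ⟨W⟩ := hcon.preconnected w r
  obtain ⟨a, u, ha, hu, h, hue⟩ := exists_attach hD W hw
  obtain ⟨b₀, hb₀, hb₀a⟩ := cycle_exists_ne hF a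
  obtain ⟨W', hW'⟩ := path_avoid (h2 a) h.ne' hb₀a
  obtain ⟨b, hb, Q, hQ1, hQ2⟩ := first_hit {x | x ∈ F.support} W' hb₀
  have hbs : ∀ x ∈ Q.bypass.support, x ∈ Q.support := fun x hx => Q.support_bypass_subset_support hx
  have haQ : a ∉ Q.support := fun hh => hW' (hQ1 a hh)
  refine ⟨a, u, h, ear_improve hD hF ha hb (fun e => haQ (e ▸ Q.end_mem_support)) h Q.bypass
    Q.bypass_isPath (fun hh => haQ (hbs _ hh)) (fun x hx => hQ2 x (hbs x hx))
    (fun he => hu (Walk.snd_mem_support_of_mem_edges _ he)) ⟨D.pos u, ?_, hue⟩⟩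
  rw [walkSet_cons]
  exact Or.inl (arcSet_isArc D h).right_mem

lemma cycle_improve [DecidableEq V] (hD : D.IsPlane) (hcon : G.Connected)
    (h2 : ∀ v : V, (G.induce ({v}ᶜ : Set V)).Connected)
    {r : V} {F : G.Walk r r} (hF : F.IsCycle) (hm : (D.graphSet ∩ ext (D.walkSet F)).Nonempty) :
    ∃ (a u : V) (h : G.Adj a u) (F' : G.Walk a a), F'.IsCycle ∧
      ext (D.walkSet F') ⊆ ext (D.walkSet F) ∧
      (D.arcSet h ∩ ext (D.walkSet F)).Nonempty ∧ D.arcSet h ∩ ext (D.walkSet F') = ∅ := by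
  obtain ⟨z, hz, hze⟩ := hm
  rcases hz with ⟨w, rfl⟩ | hz
  · exact vertex_improve hD hcon h2 hF hze
  simp only [mem_iUnion] at hz
  obtain ⟨x, y, h, hz⟩ := hz
  have he : s(x, y) ∉ F.edges := by
    intro he
    apply hze.1
    rw [mem_walkSet]
    right
    obtain ⟨d, hd, e⟩ := List.mem_map.1 he
    have e' : s(d.fst, d.snd) = s(x, y) := e
    refine ⟨d, hd, ?_⟩
    rw [arcSet_congr D d.adj h e']
    exact hz
  -- an endpoint off the cycle lies in the exterior
  have key : ∀ {x y : V} (h : G.Adj x y), z ∈ D.arcSet h → s(x, y) ∉ F.edges → x ∉ F.support →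
      ∃ w, D.pos w ∈ ext (D.walkSet F) := by
    intro x y h hz he hx
    rcases mem_arcSet_cases D h hz with rfl | rfl | hi
    · exact ⟨x, hze⟩
    · exact ⟨y, hze⟩
    refine ⟨x, ?_⟩
    have hI : IsPreconnected (D.arc h '' Ico 0 1) :=
      isPreconnected_Ico.image _ (D.arc h).continuous.continuousOn
    refine subset_ext hI ?_ ?_ ⟨0, ⟨le_rfl, zero_lt_one⟩, (D.arc h).source⟩
    · rintro s ⟨t, ht, rfl⟩ hs
      obtain ⟨w, hw, rfl | rfl, e⟩ := arc_cycle_inter hD h he ⟨t, rfl⟩ hs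
      · exact hx hw
      · exact ht.2.ne (D.arc_inj h (e.trans (D.arc h).target.symm))
    · obtain ⟨t, ⟨ht0, ht1⟩, e⟩ := hi
      exact ⟨z, ⟨t, ⟨t.2.1, unitInterval.lt_one_iff_ne_one.2 ht1⟩, e⟩, hze⟩
  by_cases hx : x ∈ F.support
  · by_cases hy : y ∈ F.support
    · refine ⟨x, y, h, ear_improve hD hF hx hy h.ne h Walk.nil Walk.IsPath.nil
        (by simpa using h.ne) (by simp) he ⟨z, ?_, hze⟩⟩
      rw [walkSet_cons]; exact Or.inl hz
    · obtain ⟨w, hw⟩ := key h.symm (by rw [arcSet_symm D h]; exact hz)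
        (by rwa [Sym2.eq_swap]) hy
      exact vertex_improve hD hcon h2 hF hw
  · obtain ⟨w, hw⟩ := key h hz he hx
    exact vertex_improve hD hcon h2 hF hw

variable (D) in
/-- Pairs of adjacent vertices whose arc does not meet the exterior of a closed walk. -/
def covered {r : V} (F : G.Walk r r) : Set (V × V) :=
  {e | ∃ h : G.Adj e.1 e.2, D.arcSet h ∩ ext (D.walkSet F) = ∅}

lemma exists_outer_cycle [Finite V] [DecidableEq V] (hD : D.IsPlane) (hcon : G.Connected)
    (h2 : ∀ v : V, (G.induce ({v}ᶜ : Set V)).Connected)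
    {r : V} {F : G.Walk r r} (hF : F.IsCycle) :
    ∃ (r : V) (F : G.Walk r r), F.IsCycle ∧ D.graphSet ∩ ext (D.walkSet F) = ∅ := by
  by_contra hno
  push Not at hno
  have key : ∀ k : ℕ, ∃ (r : V) (F : G.Walk r r), F.IsCycle ∧ k ≤ (covered D F).ncard := by
    intro k
    induction k with
    | zero => exact ⟨r, F, hF, Nat.zero_le _⟩
    | succ k ih =>
      obtain ⟨r, F, hF, hk⟩ := ih
      obtain ⟨a, u, h, F', hF', hs, hne, he⟩ := cycle_improve hD hcon h2 hF (hno r F hF)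
      refine ⟨a, F', hF', ?_⟩
      have : covered D F ⊂ covered D F' := by
        rw [ssubset_iff_of_subset]
        · refine ⟨(a, u), ⟨h, he⟩, ?_⟩
          rintro ⟨h', e⟩
          exact hne.ne_empty e
        · rintro e ⟨h', e'⟩
          exact ⟨h', subset_empty_iff.1 (e' ▸ inter_subset_inter_right _ hs)⟩
      have := ncard_lt_ncard this (toFinite _)
      omega
  obtain ⟨r, F, -, h⟩ := key (Nat.card (V × V) + 1)
  have : (covered D F).ncard ≤ Nat.card (V × V) := by
    rw [← ncard_univ]; exact ncard_le_ncard (subset_univ _) (toFinite _)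
  omega

lemma boundsOuter_of_disjoint [Finite V] [DecidableEq V] (hD : D.IsPlane)
    {r : V} {F : G.Walk r r} (hF : F.IsCycle) (h : D.graphSet ∩ ext (D.walkSet F) = ∅) :
    D.BoundsOuter F := by
  have hout : D.outerFace = ext (D.walkSet F) := by
    rw [outerFace_eq]
    apply Subset.antisymm (ext_anti (walkSet_subset D F))
    intro p hp
    have hd : ∀ z ∈ ext (D.walkSet F), z ∉ D.graphSet := fun z hz hz' => by
      have : z ∈ D.graphSet ∩ ext (D.walkSet F) := ⟨hz', hz⟩
      rw [h] at this; exact this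
    refine ⟨hd p hp, fun hb => hp.2 (hb.subset ?_)⟩
    exact isPreconnected_connectedComponentIn.subset_connectedComponentIn
      (mem_connectedComponentIn hp.1) (fun z hz => hd z (ext_comp hp hz))
  unfold Drawing.BoundsOuter
  rw [hout]
  obtain ⟨b, hb, hbr⟩ := cycle_exists_ne hF r
  obtain ⟨p, q, hp, hq, hw, hpq, hed, -⟩ := cycle_split (D := D) hF F.start_mem_support hb hbr.symm
  rw [hw]
  refine IsArc.frontier_ext (path_isArc hD p hp hbr) (path_isArc hD q hq hbr) ?_
  rintro z ⟨hz1, hz2⟩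
  obtain ⟨w, hw1, hw2, rfl⟩ := walkSet_inter hD hed hz1 hz2
  rcases hpq w hw1 hw2 with rfl | rfl
  · exact Or.inr rfl
  · exact Or.inl rfl

end

lemma config_outer_cycle {C : Config} (hmin : C.Minimal) :
    ∃ (r : Fin C.n) (F : C.G.Walk r r), F.IsCycle ∧ C.D.BoundsOuter F := by
  classical
  obtain ⟨x, hx⟩ := exists_off C
  have h1 := degree_off hmin hx
  have h3 := L_ge_three C hx
  obtain ⟨y, hy, z, hz, hyz⟩ := (one_lt_ncard (toFinite (C.G.neighborSet x))).1 (by omega)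
  have h2 := (config_twoConnected hmin).2
  obtain ⟨F, hF⟩ := exists_cycle (h2 x) hy hz hyz
  obtain ⟨r, F, hF, hd⟩ := exists_outer_cycle C.plane (config_connected hmin) h2 hF
  exact ⟨r, F, hF, boundsOuter_of_disjoint C.plane hF hd⟩

end PlaneTop

/-- In a minimal counterexample configuration for the precolored-path 5-choosability
theorem, every vertex `v` satisfies `deg(v) ≥ |L(v)|`, the graph is 2-connected, and in
particular the outer face is bounded by a cycle. -/
theorem minimal_counterexample_degree_and_two_connected
    (C : Config) (hmin : C.Minimal) :
    (∀ v : Fin C.n, (C.L v).card ≤ (C.G.neighborSet v).ncard) ∧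
    TwoConnected C.G ∧
    ∃ (r : Fin C.n) (F : C.G.Walk r r), F.IsCycle ∧ C.D.BoundsOuter F := by
  exact ⟨PlaneTop.degree_all hmin, PlaneTop.config_twoConnected hmin,
    PlaneTop.config_outer_cycle hmin⟩
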